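/- arXiv:1506.01817 — 3 statements merged into one kernel-verified Lean document; each statement's English description precedes it below -/
import Mathlib

section
/- Let Λ be a free ℤ-module of finite rank n, let Ω_∞ ⊂ Λ_∞ be a bounded subset, and for each prime p let Ω_p ⊂ Λ_p. Assume: (1) μ_∞(∂Ω_∞) = 0 and μ_p(∂Ω_p) = 0 for every prime p; (2) μ_∞(Ω_∞) > 0 and μ_p(Ω_p) > 0 for every prime p; (3) lim_{M→∞} limsup_{B→∞} B^{-n}·#{x ∈ Λ : x ∈ BΩ_∞ and there exists a prime p > M with x ∉ Ω_p} = 0. Then the limit lim_{B→∞} B^{-n}·#{x ∈ Λ : x ∈ BΩ_∞ and x ∈ Ω_p for all primes p} exists, is nonzero, and equals (μ_∞(Ω_∞)/μ_∞(Λ_∞/Λ)) · ∏_p (μ_p(Ω_p)/μ_p(Λ_p)), where μ_∞(Λ_∞/Λ) is the covolume of Λ in Λ_∞ and the infinite product over primes converges. -/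
open MeasureTheory Filter Topology Pointwise

instance (p : Nat.Primes) : Fact (p : ℕ).Prime := ⟨p.2⟩

noncomputable instance (p : ℕ) [Fact p.Prime] : MeasurableSpace ℤ_[p] := borel _
instance (p : ℕ) [Fact p.Prime] : BorelSpace ℤ_[p] := ⟨rfl⟩

namespace Ekedahl

/-- Lattice points of `B • Ω` lying in `T`. -/
def cset {n : ℕ} (Ω : Set (Fin n → ℝ)) (B : ℝ) (T : Set (Fin n → ℤ)) : Set (Fin n → ℤ) :=
  {x | (fun i => (x i : ℝ)) ∈ B • Ω ∧ x ∈ T}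

lemma cset_finite {n : ℕ} {Ω : Set (Fin n → ℝ)} (hb : Bornology.IsBounded Ω) (B : ℝ)
    (T : Set (Fin n → ℤ)) : (cset Ω B T).Finite := by
  obtain ⟨R, hR⟩ := (hb.smul₀ B).subset_closedBall (0 : Fin n → ℝ)
  refine Set.Finite.subset (Set.Finite.pi (fun _ : Fin n => Set.finite_Icc (-⌈R⌉) ⌈R⌉)) ?_
  rintro x ⟨hx, -⟩ i -
  have h1 := hR hx
  rw [mem_closedBall_zero_iff] at h1
  have h2 := (norm_le_pi_norm (fun i => (x i : ℝ)) i).trans h1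
  rw [Real.norm_eq_abs, abs_le] at h2
  have h3 := Int.le_ceil R
  constructor
  · have : ((-⌈R⌉ : ℤ) : ℝ) ≤ x i := by push_cast; linarith
    exact_mod_cast this
  · have : (x i : ℝ) ≤ ((⌈R⌉ : ℤ) : ℝ) := by linarith
    exact_mod_cast this

/-- The cube of side `D / B` with corner `x / B`. -/
def box {n : ℕ} (B : ℝ) (D : ℕ) (x : Fin n → ℤ) : Set (Fin n → ℝ) :=
  {y | ∀ i, (x i : ℝ) ≤ B * y i ∧ B * y i < x i + D}

lemma box_measurable {n : ℕ} (B : ℝ) (D : ℕ) (x : Fin n → ℤ) : MeasurableSet (box B D x) := by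
  have : box B D x = ⋂ i, ({y : Fin n → ℝ | (x i : ℝ) ≤ B * y i} ∩ {y | B * y i < x i + D}) := by
    ext y; simp [box]
  rw [this]
  refine MeasurableSet.iInter fun i => MeasurableSet.inter ?_ ?_
  · exact measurableSet_le (by fun_prop) (by fun_prop)
  · exact measurableSet_lt (by fun_prop) (by fun_prop)

lemma box_measure {n : ℕ} (μ : Measure (Fin n → ℝ)) [μ.IsAddHaarMeasure]
    {B : ℝ} (hB : 0 < B) {D : ℕ} (hD : 0 < D) (x : Fin n → ℤ) :
    μ (box B D x) = ENNReal.ofReal ((D / B) ^ n) *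
      μ (Set.univ.pi fun _ : Fin n => Set.Ico (0 : ℝ) 1) := by
  have hD' : (0 : ℝ) < D := by exact_mod_cast hD
  have hd : (0 : ℝ) < D / B := by positivity
  have : box B D x = (fun i => (x i : ℝ) / B) +ᵥ
      (((D : ℝ) / B) • (Set.univ.pi fun _ : Fin n => Set.Ico (0 : ℝ) 1)) := by
    ext y
    rw [Set.mem_vadd_set_iff_neg_vadd_mem, Set.mem_smul_set_iff_inv_smul_mem₀ hd.ne']
    simp only [box, Set.mem_ofPred_eq, Set.mem_pi, Set.mem_univ, true_imp_iff, Set.mem_Ico]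
    refine forall_congr' fun i => ?_
    have e : ((D / B : ℝ)⁻¹ • (-(fun i => (x i : ℝ) / B) +ᵥ y)) i = (B * y i - x i) / D := by
      simp only [Pi.smul_apply, vadd_eq_add, Pi.add_apply, Pi.neg_apply, smul_eq_mul]
      field_simp
      ring
    rw [e, div_lt_one hD', le_div_iff₀ hD', zero_mul]
    constructor <;> rintro ⟨h1, h2⟩ <;> constructor <;> linarith
  rw [this, measure_vadd, Measure.addHaar_smul, Module.finrank_fin_fun, abs_of_pos (by positivity)]

lemma lattice {n : ℕ} (μ : Measure (Fin n → ℝ)) [μ.IsAddHaarMeasure]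
    {Ω : Set (Fin n → ℝ)} (hb : Bornology.IsBounded Ω) (hf : μ (frontier Ω) = 0)
    {D : ℕ} (hD : 0 < D) (r : Fin n → ℤ) :
    Tendsto (fun B : ℝ => ((cset Ω B {x | ∀ i, (D : ℤ) ∣ x i - r i}).ncard : ℝ) / B ^ n) atTop
      (𝓝 ((μ Ω).toReal / (μ (Set.univ.pi fun _ : Fin n => Set.Ico (0 : ℝ) 1)).toReal
        / (D : ℝ) ^ n)) := by
  set c := μ (Set.univ.pi fun _ : Fin n => Set.Ico (0 : ℝ) 1) with hc
  have hD' : (0 : ℝ) < D := by exact_mod_cast hD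
  have hcpos : 0 < c := by
    have ho : IsOpen (Set.univ.pi fun _ : Fin n => Set.Ioo (0 : ℝ) 1) :=
      isOpen_set_pi Set.finite_univ (fun _ _ => isOpen_Ioo)
    have hne : (Set.univ.pi fun _ : Fin n => Set.Ioo (0 : ℝ) 1).Nonempty :=
      ⟨fun _ => 1 / 2, fun i _ => by constructor <;> norm_num⟩
    exact (ho.measure_pos μ hne).trans_le
      (measure_mono (Set.pi_mono fun _ _ => Set.Ioo_subset_Ico_self))
  have hctop : c ≠ ⊤ := by
    refine (Bornology.IsBounded.measure_lt_top ?_).ne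
    exact Bornology.IsBounded.pi fun _ => Metric.isBounded_Ico 0 1
  set T : Set (Fin n → ℤ) := {x | ∀ i, (D : ℤ) ∣ x i - r i} with hT
  let U : ℝ → Set (Fin n → ℝ) := fun B => ⋃ x ∈ (cset_finite hb B T).toFinset, box B D x
  have hU : ∀ B : ℝ, 0 < B →
      μ (U B) = (cset Ω B T).ncard * (ENNReal.ofReal ((D / B) ^ n) * c) := by
    intro B hB
    rw [measure_biUnion_finset, Finset.sum_congr rfl (fun x _ => box_measure μ hB hD x)]
    · rw [Finset.sum_const, nsmul_eq_mul, Set.ncard_eq_toFinset_card _ (cset_finite hb B T)]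
    · intro x hx y hy hxy
      rw [Function.onFun, Set.disjoint_left]
      intro z hz hz'
      apply hxy
      simp only [Set.Finite.coe_toFinset, cset, hT, Set.mem_ofPred_eq] at hx hy
      funext i
      obtain ⟨a, ha⟩ := hx.2 i
      obtain ⟨b, hb⟩ := hy.2 i
      have h1 : (x i : ℝ) < y i + D := by linarith [(hz i).1, (hz' i).2]
      have h2 : (y i : ℝ) < x i + D := by linarith [(hz' i).1, (hz i).2]
      have h1' : x i < y i + D := by exact_mod_cast h1
      have h2' : y i < x i + D := by exact_mod_cast h2
      have hDz : (0 : ℤ) < D := by exact_mod_cast hD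
      have h3 : a < b + 1 := by
        refine lt_of_mul_lt_mul_left (a := (D : ℤ)) ?_ hDz.le
        linarith
      have h4 : b < a + 1 := by
        refine lt_of_mul_lt_mul_left (a := (D : ℤ)) ?_ hDz.le
        linarith
      have : a = b := by omega
      subst this
      linarith
    · intro x _
      exact box_measurable _ _ _
  have hdist : ∀ B : ℝ, 0 < B → ∀ x : Fin n → ℤ, ∀ y ∈ box B D x,
      dist y (B⁻¹ • fun i => (x i : ℝ)) ≤ D / B := by
    intro B hB x y hy
    rw [dist_pi_le_iff (by positivity)]
    intro i
    have e : y i - B⁻¹ * x i = (B * y i - x i) / B := by field_simp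
    simp only [Pi.smul_apply, smul_eq_mul]
    rw [Real.dist_eq, e, abs_of_nonneg (div_nonneg (by linarith [(hy i).1]) hB.le)]
    gcongr
    linarith [(hy i).2]
  have hcover : ∀ B : ℝ, 0 < B → ∀ y : Fin n → ℝ, ∃ x ∈ T, y ∈ box B D x := by
    intro B hB y
    refine ⟨fun i => r i + D * ⌊(B * y i - r i) / D⌋, fun i => ?_, fun i => ?_⟩
    · simp
    · have h1 := Int.floor_le ((B * y i - r i) / D)
      have h2 := Int.lt_floor_add_one ((B * y i - r i) / D)
      rw [le_div_iff₀ hD'] at h1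
      rw [div_lt_iff₀ hD'] at h2
      push_cast
      constructor <;> linarith
  have hδ : Tendsto (fun B : ℝ => (D : ℝ) / B) atTop (𝓝 0) :=
    tendsto_const_nhds.div_atTop tendsto_id
  have hcl : μ (closure Ω) = μ Ω := by
    refine le_antisymm ?_ (measure_mono subset_closure)
    rw [closure_eq_self_union_frontier]
    refine (measure_union_le _ _).trans ?_
    simp [hf]
  have hup : Tendsto (fun B : ℝ => μ (Metric.cthickening (D / B) Ω)) atTop (𝓝 (μ Ω)) := by
    rw [← hcl]
    exact (tendsto_measure_cthickening
      ⟨1, one_pos, hb.cthickening.measure_lt_top.ne⟩).comp hδ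
  have hfinΩ : μ (closure Ω) ≠ ⊤ := hb.closure.measure_lt_top.ne
  have hlo0 : Tendsto (fun B : ℝ => μ.restrict (closure Ω) (Metric.cthickening (D / B) Ωᶜ)) atTop
      (𝓝 0) := by
    have h0 : μ.restrict (closure Ω) (closure Ωᶜ) = 0 := by
      rw [Measure.restrict_apply isClosed_closure.measurableSet, Set.inter_comm,
        ← frontier_eq_closure_inter_closure, hf]
    rw [← h0]
    refine (tendsto_measure_cthickening ⟨1, one_pos, ?_⟩).comp hδ
    refine ne_top_of_le_ne_top hfinΩ ?_
    exact (measure_mono (Set.subset_univ _)).trans (by simp)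
  have hlo : Tendsto (fun B : ℝ => μ Ω - μ.restrict (closure Ω) (Metric.cthickening (D / B) Ωᶜ))
      atTop (𝓝 (μ Ω)) := by
    have := ENNReal.Tendsto.sub (tendsto_const_nhds (x := μ Ω) (f := atTop (α := ℝ))) hlo0
      (Or.inr ENNReal.zero_ne_top)
    simpa using this
  have hmain : Tendsto (fun B => μ (U B)) atTop (𝓝 (μ Ω)) := by
    refine tendsto_of_tendsto_of_tendsto_of_le_of_le' hlo hup ?_ ?_
    · filter_upwards [eventually_gt_atTop 0] with B hB
      rw [tsub_le_iff_right, Measure.restrict_apply Metric.isClosed_cthickening.measurableSet]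
      refine (measure_mono ?_).trans (measure_union_le _ _)
      intro y hy
      by_cases hy' : y ∈ Metric.cthickening (D / B) Ωᶜ
      · exact Or.inr ⟨hy', subset_closure hy⟩
      · left
        obtain ⟨x, hxT, hx⟩ := hcover B hB y
        simp only [U, Set.mem_iUnion, Set.Finite.mem_toFinset]
        refine ⟨x, ⟨?_, hxT⟩, hx⟩
        rw [Set.mem_smul_set_iff_inv_smul_mem₀ hB.ne']
        by_contra hcon
        exact hy' (Metric.mem_cthickening_of_dist_le _ _ _ _ hcon (hdist B hB x y hx))
    · filter_upwards [eventually_gt_atTop 0] with B hB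
      refine measure_mono ?_
      intro y hy
      simp only [U, Set.mem_iUnion, Set.Finite.mem_toFinset] at hy
      obtain ⟨x, ⟨hx1, -⟩, hx⟩ := hy
      rw [Set.mem_smul_set_iff_inv_smul_mem₀ hB.ne'] at hx1
      exact Metric.mem_cthickening_of_dist_le _ _ _ _ hx1 (hdist B hB x y hx)
  have hreal := (ENNReal.tendsto_toReal (hcl ▸ hfinΩ)).comp hmain
  have hfinal := (hreal.div_const c.toReal).div_const ((D : ℝ) ^ n)
  refine hfinal.congr' ?_
  filter_upwards [eventually_gt_atTop 0] with B hB
  have hcr : c.toReal ≠ 0 := (ENNReal.toReal_pos hcpos.ne' hctop).ne'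
  simp only [Function.comp]
  rw [hU B hB, ENNReal.toReal_mul, ENNReal.toReal_mul, ENNReal.toReal_ofReal (by positivity)]
  simp only [ENNReal.toReal_natCast]
  rw [div_pow]
  field_simp

lemma cov_pos {n : ℕ} (μ : Measure (Fin n → ℝ)) [μ.IsAddHaarMeasure] :
    0 < (μ (Set.univ.pi fun _ : Fin n => Set.Ico (0 : ℝ) 1)).toReal := by
  refine ENNReal.toReal_pos (ne_of_gt ?_) ?_
  · have ho : IsOpen (Set.univ.pi fun _ : Fin n => Set.Ioo (0 : ℝ) 1) :=
      isOpen_set_pi Set.finite_univ (fun _ _ => isOpen_Ioo)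
    have hne : (Set.univ.pi fun _ : Fin n => Set.Ioo (0 : ℝ) 1).Nonempty :=
      ⟨fun _ => 1 / 2, fun i _ => by constructor <;> norm_num⟩
    exact (ho.measure_pos μ hne).trans_le
      (measure_mono (Set.pi_mono fun _ _ => Set.Ioo_subset_Ico_self))
  · refine (Bornology.IsBounded.measure_lt_top ?_).ne
    exact Bornology.IsBounded.pi fun _ => Metric.isBounded_Ico 0 1

lemma periodic {n : ℕ} (μ : Measure (Fin n → ℝ)) [μ.IsAddHaarMeasure]
    {Ω : Set (Fin n → ℝ)} (hb : Bornology.IsBounded Ω) (hf : μ (frontier Ω) = 0)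
    {D : ℕ} (hD : 0 < D) {H : Type*} [Finite H] (φ : (Fin n → ℤ) → H)
    (hφ : Function.Surjective φ) (hφ' : ∀ x y, φ x = φ y ↔ ∀ i, (D : ℤ) ∣ x i - y i)
    (T : Set H) :
    Tendsto (fun B : ℝ => ((cset Ω B (φ ⁻¹' T)).ncard : ℝ) / B ^ n) atTop
      (𝓝 ((μ Ω).toReal / (μ (Set.univ.pi fun _ : Fin n => Set.Ico (0 : ℝ) 1)).toReal
        * ((T.ncard : ℝ) / (D : ℝ) ^ n))) := by
  classical
  have hTf : T.Finite := Set.toFinite T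
  choose ψ hψ using hφ
  have h := tendsto_finsetSum hTf.toFinset (fun t _ => lattice μ hb hf hD (ψ t))
  rw [Finset.sum_const, nsmul_eq_mul, ← Set.ncard_eq_toFinset_card _ hTf] at h
  have e : ∀ V : ℝ, V * ((T.ncard : ℝ) / (D : ℝ) ^ n) = T.ncard * (V / (D : ℝ) ^ n) := by
    intro V; ring
  rw [e]
  refine h.congr fun B => ?_
  rw [← Finset.sum_div]
  congr 1
  rw [Set.ncard_eq_toFinset_card _ (cset_finite hb B (φ ⁻¹' T)),
    Finset.card_eq_sum_card_fiberwise (f := φ) (t := hTf.toFinset)]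
  · push_cast
    refine Finset.sum_congr rfl fun t ht => ?_
    rw [Set.ncard_eq_toFinset_card _ (cset_finite hb B _)]
    congr 2
    ext x
    have hx : φ x = t ↔ ∀ i, (D : ℤ) ∣ x i - ψ t i := by rw [← hφ', hψ]
    simp only [Finset.mem_filter, Set.Finite.mem_toFinset, cset, Set.mem_ofPred_eq,
      Set.mem_preimage] at ht ⊢
    rw [← hx]
    constructor
    · rintro ⟨h1, h2⟩
      exact ⟨⟨h1, h2 ▸ ht⟩, h2⟩
    · rintro ⟨⟨h1, -⟩, h2⟩
      exact ⟨h1, h2⟩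
  · intro x hx
    simp only [Set.Finite.coe_toFinset, cset, Set.mem_ofPred_eq, Set.mem_preimage] at hx ⊢
    exact hx.2

/-- Reduction modulo `p ^ k`. -/
noncomputable def red (n p : ℕ) [Fact p.Prime] (k : ℕ) (x : Fin n → ℤ_[p]) :
    Fin n → ZMod (p ^ k) := fun i => PadicInt.toZModPow k (x i)

lemma red_eq_iff {n p : ℕ} [Fact p.Prime] {k : ℕ} {x y : Fin n → ℤ_[p]} :
    red n p k x = red n p k y ↔ dist x y ≤ (p : ℝ) ^ (-k : ℤ) := by
  have hp : (0 : ℝ) < p := by exact_mod_cast (Fact.out : p.Prime).pos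
  rw [dist_pi_le_iff (by positivity), funext_iff]
  refine forall_congr' fun i => ?_
  rw [dist_eq_norm, PadicInt.norm_le_pow_iff_mem_span_pow, ← PadicInt.ker_toZModPow,
    RingHom.mem_ker, map_sub, sub_eq_zero]
  rfl

lemma red_surj (n p : ℕ) [Fact p.Prime] (k : ℕ) : Function.Surjective (red n p k) := by
  intro t
  choose z hz using fun i => ZMod.ringHom_surjective (PadicInt.toZModPow (p := p) k) (t i)
  exact ⟨z, funext hz⟩

lemma red_measure {n p : ℕ} [Fact p.Prime] (μ : Measure (Fin n → ℤ_[p])) [μ.IsAddHaarMeasure]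
    (k : ℕ) (T : Set (Fin n → ZMod (p ^ k))) :
    μ (red n p k ⁻¹' T) = T.ncard * μ (Metric.closedBall 0 ((p : ℝ) ^ (-k : ℤ))) := by
  classical
  have : NeZero (p ^ k) := ⟨pow_ne_zero _ (Fact.out : p.Prime).ne_zero⟩
  have hTf : T.Finite := Set.toFinite T
  have hball : ∀ x : Fin n → ℤ_[p],
      red n p k ⁻¹' {red n p k x} = Metric.closedBall x ((p : ℝ) ^ (-k : ℤ)) := by
    intro x
    ext y
    simp [red_eq_iff]
  have hm : ∀ t, MeasurableSet (red n p k ⁻¹' {t}) := by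
    intro t
    obtain ⟨x, rfl⟩ := red_surj n p k t
    rw [hball]
    exact Metric.isClosed_closedBall.measurableSet
  have hμ : ∀ t, μ (red n p k ⁻¹' {t}) = μ (Metric.closedBall 0 ((p : ℝ) ^ (-k : ℤ))) := by
    intro t
    obtain ⟨x, rfl⟩ := red_surj n p k t
    rw [hball]
    exact Measure.addHaar_closedBall_center μ x _
  have hU : red n p k ⁻¹' T = ⋃ t ∈ hTf.toFinset, red n p k ⁻¹' {t} := by
    ext x; simp
  rw [hU, measure_biUnion_finset, Finset.sum_congr rfl (fun t _ => hμ t)]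
  · rw [Finset.sum_const, nsmul_eq_mul, Set.ncard_eq_toFinset_card _ hTf]
  · intro s _ t _ hst
    exact Disjoint.preimage _ (by simpa using hst)
  · intro t _
    exact hm t

lemma red_density {n p : ℕ} [Fact p.Prime] (μ : Measure (Fin n → ℤ_[p])) [μ.IsAddHaarMeasure]
    (k : ℕ) (T : Set (Fin n → ZMod (p ^ k))) :
    (T.ncard : ℝ) / ((p : ℝ) ^ k) ^ n = (μ (red n p k ⁻¹' T)).toReal / (μ Set.univ).toReal := by
  have hpp := (Fact.out : p.Prime).pos
  have hp : (0 : ℝ) < p := by exact_mod_cast hpp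
  have : NeZero (p ^ k) := ⟨pow_ne_zero _ (Fact.out : p.Prime).ne_zero⟩
  have h1 := red_measure μ k T
  have h2 := red_measure μ k Set.univ
  rw [Set.preimage_univ, Set.ncard_univ] at h2
  have hcard : Nat.card (Fin n → ZMod (p ^ k)) = (p ^ k) ^ n := by
    simp [Nat.card_eq_fintype_card, ZMod.card]
  rw [hcard] at h2
  have hpos : 0 < (μ (Metric.closedBall 0 ((p : ℝ) ^ (-k : ℤ)))).toReal := by
    refine ENNReal.toReal_pos ?_ ?_
    · exact (Metric.measure_closedBall_pos μ _ (by positivity)).ne'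
    · exact (isCompact_univ.of_isClosed_subset Metric.isClosed_closedBall
        (Set.subset_univ _)).measure_lt_top.ne
  rw [h1, h2, ENNReal.toReal_mul, ENNReal.toReal_mul, ENNReal.toReal_natCast,
    ENNReal.toReal_natCast, mul_div_mul_right _ _ hpos.ne']
  push_cast
  rfl

lemma red_tendsto {n p : ℕ} [Fact p.Prime] (μ : Measure (Fin n → ℤ_[p])) [μ.IsAddHaarMeasure]
    (Ω : Set (Fin n → ℤ_[p])) (hf : μ (frontier Ω) = 0) :
    Tendsto (fun k : ℕ => ((red n p k '' Ω).ncard : ℝ) / ((p : ℝ) ^ k) ^ n) atTop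
      (𝓝 ((μ Ω).toReal / (μ Set.univ).toReal)) := by
  have hp1 : (1 : ℝ) < p := by exact_mod_cast (Fact.out : p.Prime).one_lt
  have htop : ∀ s : Set (Fin n → ℤ_[p]), μ s ≠ ⊤ := fun s => measure_ne_top μ s
  have hcl : μ (closure Ω) = μ Ω := by
    refine le_antisymm ?_ (measure_mono subset_closure)
    rw [closure_eq_self_union_frontier]
    refine (measure_union_le _ _).trans ?_
    simp [hf]
  have hδ : Tendsto (fun k : ℕ => (p : ℝ) ^ (-k : ℤ)) atTop (𝓝 0) := by
    have := tendsto_pow_atTop_nhds_zero_of_lt_one (r := (p : ℝ)⁻¹) (by positivity)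
      (inv_lt_one_of_one_lt₀ hp1)
    refine this.congr fun k => ?_
    rw [zpow_neg, zpow_natCast, inv_pow]
  have hup : Tendsto (fun k : ℕ => μ (Metric.cthickening ((p : ℝ) ^ (-k : ℤ)) Ω)) atTop
      (𝓝 (μ Ω)) := by
    rw [← hcl]
    exact (tendsto_measure_cthickening ⟨1, one_pos, htop _⟩).comp hδ
  have hmain : Tendsto (fun k : ℕ => μ (red n p k ⁻¹' (red n p k '' Ω))) atTop (𝓝 (μ Ω)) := by
    refine tendsto_of_tendsto_of_tendsto_of_le_of_le tendsto_const_nhds hup ?_ ?_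
    · intro k
      exact measure_mono (Set.subset_preimage_image _ _)
    · intro k
      refine measure_mono ?_
      rintro y ⟨x, hx, hxy⟩
      exact Metric.mem_cthickening_of_dist_le _ _ _ _ hx (red_eq_iff.1 hxy.symm)
  have := ((ENNReal.tendsto_toReal (htop Ω)).comp hmain).div_const (μ Set.univ).toReal
  refine this.congr fun k => ?_
  rw [red_density μ]
  rfl

lemma finite_periodic {n : ℕ} (μ : Measure (Fin n → ℝ)) [μ.IsAddHaarMeasure]
    {Ω : Set (Fin n → ℝ)} (hb : Bornology.IsBounded Ω) (hf : μ (frontier Ω) = 0)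
    (S : Finset Nat.Primes) (k : ℕ) (T : ∀ p : Nat.Primes, Set (Fin n → ZMod ((p : ℕ) ^ k))) :
    Tendsto (fun B : ℝ => ((cset Ω B {x | ∀ p ∈ S, (fun i => (x i : ZMod ((p : ℕ) ^ k))) ∈
        T p}).ncard : ℝ) / B ^ n) atTop
      (𝓝 ((μ Ω).toReal / (μ (Set.univ.pi fun _ : Fin n => Set.Ico (0 : ℝ) 1)).toReal
        * ∏ p ∈ S, (((T p).ncard : ℝ) / (((p : ℕ) : ℝ) ^ k) ^ n))) := by
  classical
  have hne : ∀ p : Nat.Primes, NeZero ((p : ℕ) ^ k) := fun p => ⟨pow_ne_zero _ p.2.ne_zero⟩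
  let a : S → ℕ := fun p => ((p : Nat.Primes) : ℕ) ^ k
  have hcop : Pairwise (Function.onFun Nat.Coprime a) := by
    intro p q hpq
    refine Nat.Coprime.pow _ _ ((Nat.coprime_primes p.1.2 q.1.2).2 ?_)
    intro h
    exact hpq (Subtype.ext (Subtype.ext h))
  have hD : 0 < ∏ p, a p := Finset.prod_pos fun p _ => pow_pos p.1.2.pos _
  let φ : (Fin n → ℤ) → ∀ p : S, Fin n → ZMod (a p) := fun x p i => (x i : ZMod (a p))
  have hfin : Finite (∀ p : S, Fin n → ZMod (a p)) := by
    have : ∀ p : S, Finite (ZMod (a p)) := fun p => by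
      have := hne p.1
      exact inferInstanceAs (Finite (ZMod (((p : Nat.Primes) : ℕ) ^ k)))
    infer_instance
  have hsurj : Function.Surjective φ := by
    intro t
    choose z hz using fun i => ZMod.intCast_surjective
      ((ZMod.prodEquivPi a hcop).symm (fun p => t p i))
    refine ⟨z, ?_⟩
    funext p i
    have := congrArg (ZMod.prodEquivPi a hcop) (hz i)
    rw [RingEquiv.apply_symm_apply, map_intCast] at this
    exact congrFun this p
  have hker : ∀ x y, φ x = φ y ↔ ∀ i, ((∏ p, a p : ℕ) : ℤ) ∣ x i - y i := by
    intro x y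
    have h1 : φ x = φ y ↔ ∀ i, (fun p => (x i : ZMod (a p))) = (fun p => (y i : ZMod (a p))) := by
      simp only [funext_iff, φ]
      exact forall_comm
    rw [h1]
    refine forall_congr' fun i => ?_
    have h2 : ∀ z : ℤ, (fun p => (z : ZMod (a p))) =
        ZMod.prodEquivPi a hcop (z : ZMod (∏ p, a p)) := by
      intro z
      rw [map_intCast]
      rfl
    rw [h2, h2, (ZMod.prodEquivPi a hcop).injective.eq_iff, eq_comm,
      ZMod.intCast_eq_intCast_iff_dvd_sub]
  have h := periodic μ hb hf hD φ hsurj hker (Set.univ.pi fun p => T p.1)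
  have hcard : ((Set.univ.pi fun p : S => T p.1).ncard : ℝ) / ((∏ p, a p : ℕ) : ℝ) ^ n
      = ∏ p ∈ S, (((T p).ncard : ℝ) / (((p : ℕ) : ℝ) ^ k) ^ n) := by
    rw [← Finset.prod_coe_sort S, Finset.prod_div_distrib]
    congr 1
    · rw [← Nat.card_coe_set_eq, Nat.card_congr (Equiv.Set.univPi _), Nat.card_pi]
      push_cast
      rfl
    · push_cast
      rw [← Finset.prod_pow]
      refine Finset.prod_congr rfl fun p _ => ?_
      simp [a]
  rw [hcard] at h
  refine h.congr fun B => ?_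
  congr 3
  congr 1
  ext x
  simp [φ, a]

lemma cset_mono {n : ℕ} {Ω : Set (Fin n → ℝ)} (hb : Bornology.IsBounded Ω) {B : ℝ} (hB : 0 < B)
    {S T : Set (Fin n → ℤ)} (h : S ⊆ T) :
    ((cset Ω B S).ncard : ℝ) / B ^ n ≤ ((cset Ω B T).ncard : ℝ) / B ^ n := by
  gcongr
  · exact cset_finite hb B T
  · exact fun x hx => ⟨hx.1, h hx.2⟩

lemma cset_union {n : ℕ} {Ω : Set (Fin n → ℝ)} (hb : Bornology.IsBounded Ω) {B : ℝ} (hB : 0 < B)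
    {S T R : Set (Fin n → ℤ)} (h : S ⊆ T ∪ R) :
    ((cset Ω B S).ncard : ℝ) / B ^ n ≤
      ((cset Ω B T).ncard : ℝ) / B ^ n + ((cset Ω B R).ncard : ℝ) / B ^ n := by
  rw [← add_div]
  gcongr
  have h1 : cset Ω B S ⊆ cset Ω B T ∪ cset Ω B R := fun x hx =>
    (h hx.2).imp (fun h => ⟨hx.1, h⟩) (fun h => ⟨hx.1, h⟩)
  have := (Set.ncard_le_ncard h1 ((cset_finite hb B T).union (cset_finite hb B R))).trans
    (Set.ncard_union_le _ _)
  exact_mod_cast this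

lemma finite_sieve {n : ℕ} (μ : Measure (Fin n → ℝ)) [μ.IsAddHaarMeasure]
    {Ω : Set (Fin n → ℝ)} (hb : Bornology.IsBounded Ω) (hf : μ (frontier Ω) = 0)
    (μp : ∀ p : Nat.Primes, Measure (Fin n → ℤ_[(p : ℕ)]))
    (hHaar : ∀ p, (μp p).IsAddHaarMeasure)
    (Ωp : ∀ p : Nat.Primes, Set (Fin n → ℤ_[(p : ℕ)]))
    (hfp : ∀ p, μp p (frontier (Ωp p)) = 0) (S : Finset Nat.Primes) :
    Tendsto (fun B : ℝ => ((cset Ω B {x | ∀ p ∈ S, (fun i => (x i : ℤ_[(p : ℕ)])) ∈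
        Ωp p}).ncard : ℝ) / B ^ n) atTop
      (𝓝 ((μ Ω).toReal / (μ (Set.univ.pi fun _ : Fin n => Set.Ico (0 : ℝ) 1)).toReal
        * ∏ p ∈ S, ((μp p (Ωp p)).toReal / (μp p Set.univ).toReal))) := by
  have hred : ∀ (p : Nat.Primes) (k : ℕ) (x : Fin n → ℤ),
      red n p k (fun i => (x i : ℤ_[(p : ℕ)])) = fun i => (x i : ZMod ((p : ℕ) ^ k)) := by
    intro p k x
    funext i
    simp [red]
  have hup : Tendsto (fun k : ℕ => (μ Ω).toReal /
      (μ (Set.univ.pi fun _ : Fin n => Set.Ico (0 : ℝ) 1)).toReal *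
      ∏ p ∈ S, (((red n p k '' Ωp p).ncard : ℝ) / (((p : ℕ) : ℝ) ^ k) ^ n)) atTop
      (𝓝 ((μ Ω).toReal / (μ (Set.univ.pi fun _ : Fin n => Set.Ico (0 : ℝ) 1)).toReal
        * ∏ p ∈ S, ((μp p (Ωp p)).toReal / (μp p Set.univ).toReal))) := by
    refine Tendsto.const_mul _ (tendsto_finsetProd _ fun p _ => ?_)
    have := hHaar p
    exact red_tendsto (μp p) (Ωp p) (hfp p)
  have hlo : Tendsto (fun k : ℕ => (μ Ω).toReal /
      (μ (Set.univ.pi fun _ : Fin n => Set.Ico (0 : ℝ) 1)).toReal *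
      ∏ p ∈ S, ((((red n p k '' (Ωp p)ᶜ)ᶜ).ncard : ℝ) / (((p : ℕ) : ℝ) ^ k) ^ n)) atTop
      (𝓝 ((μ Ω).toReal / (μ (Set.univ.pi fun _ : Fin n => Set.Ico (0 : ℝ) 1)).toReal
        * ∏ p ∈ S, ((μp p (Ωp p)).toReal / (μp p Set.univ).toReal))) := by
    refine Tendsto.const_mul _ (tendsto_finsetProd _ fun p _ => ?_)
    have := hHaar p
    have h1 := red_tendsto (μp p) (Ωp p)ᶜ (by rw [frontier_compl]; exact hfp p)
    have hu : 0 < (μp p Set.univ).toReal :=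
      ENNReal.toReal_pos (by simp [NeZero.ne]) (measure_ne_top _ _)
    have hnm : NullMeasurableSet (Ωp p) (μp p) := nullMeasurableSet_of_null_frontier (hfp p)
    have hadd : (μp p (Ωp p)).toReal + (μp p (Ωp p)ᶜ).toReal = (μp p Set.univ).toReal := by
      rw [← ENNReal.toReal_add (measure_ne_top _ _) (measure_ne_top _ _),
        measure_add_measure_compl₀ hnm]
    have h2 := h1.const_sub 1
    have e : 1 - (μp p (Ωp p)ᶜ).toReal / (μp p Set.univ).toReal =
        (μp p (Ωp p)).toReal / (μp p Set.univ).toReal := by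
      rw [eq_div_iff hu.ne', sub_mul, div_mul_cancel₀ _ hu.ne']; linarith
    rw [e] at h2
    refine h2.congr fun k => ?_
    have : NeZero ((p : ℕ) ^ k) := ⟨pow_ne_zero _ p.2.ne_zero⟩
    have hp : (0 : ℝ) < (p : ℕ) := by exact_mod_cast p.2.pos
    have hc := Set.ncard_add_ncard_compl (red n p k '' (Ωp p)ᶜ)
    have hcard : Nat.card (Fin n → ZMod ((p : ℕ) ^ k)) = ((p : ℕ) ^ k) ^ n := by
      simp [Nat.card_eq_fintype_card, ZMod.card]
    rw [hcard] at hc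
    have hc' : ((red n p k '' (Ωp p)ᶜ).ncard : ℝ) + ((red n p k '' (Ωp p)ᶜ)ᶜ).ncard =
      (((p : ℕ) : ℝ) ^ k) ^ n := by exact_mod_cast hc
    rw [← hc', eq_div_iff (by rw [hc']; positivity), sub_mul, div_mul_cancel₀ _ (by rw [hc']; positivity)]
    ring
  rw [tendsto_order]
  constructor
  · intro c hc
    obtain ⟨k, hk⟩ := ((tendsto_order.1 hlo).1 c hc).exists
    have := finite_periodic μ hb hf S k (fun p => (red n p k '' (Ωp p)ᶜ)ᶜ)
    filter_upwards [(tendsto_order.1 this).1 c hk, eventually_gt_atTop 0] with B h1 hB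
    refine h1.trans_le (cset_mono hb hB ?_)
    intro x hx p hp
    by_contra hcon
    refine hx p hp ⟨_, hcon, hred p k x⟩
  · intro c hc
    obtain ⟨k, hk⟩ := ((tendsto_order.1 hup).2 c hc).exists
    have := finite_periodic μ hb hf S k (fun p => red n p k '' (Ωp p))
    filter_upwards [(tendsto_order.1 this).2 c hk, eventually_gt_atTop 0] with B h1 hB
    refine (cset_mono hb hB ?_).trans_lt h1
    intro x hx p hp
    exact ⟨_, hx p hp, hred p k x⟩

end Ekedahl

/-- The sieve of Ekedahl (Poonen–Stoll form) for a free `ℤ`-module `Λ` of rank `n`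
(realized as `ℤⁿ ⊂ ℝⁿ` and `ℤⁿ ⊂ ℤ_pⁿ`): given a bounded `Ω_∞ ⊂ Λ_∞ = ℝⁿ` and
`Ω_p ⊂ Λ_p = ℤ_pⁿ` whose boundaries are null and which have positive measure, for Haar
measures `μ_∞` and `μ_p` with `μ_p(Λ_p) = 1` for all but finitely many `p`, and assuming the
tail condition (3), the limit `lim_{B→∞} B⁻ⁿ·#{x ∈ Λ ∩ BΩ_∞ : x ∈ Ω_p ∀p}` exists, is
nonzero, and equals `(μ_∞(Ω_∞)/μ_∞(Λ_∞/Λ))·∏_p (μ_p(Ω_p)/μ_p(Λ_p))`, the covolume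
`μ_∞(Λ_∞/Λ)` being the `μ_∞`-measure of the fundamental domain `[0,1)ⁿ` and the product over
all primes being convergent. -/
theorem sieve_of_ekedahl_free_module (n : ℕ)
    (μinf : Measure (Fin n → ℝ)) [μinf.IsAddHaarMeasure]
    (μp : ∀ p : Nat.Primes, Measure (Fin n → ℤ_[(p : ℕ)]))
    (hHaar : ∀ p, (μp p).IsAddHaarMeasure)
    (hmass : {p : Nat.Primes | μp p Set.univ ≠ 1}.Finite)
    (Ωinf : Set (Fin n → ℝ)) (Ωp : ∀ p : Nat.Primes, Set (Fin n → ℤ_[(p : ℕ)]))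
    (hbdd : Bornology.IsBounded Ωinf)
    (hfrontinf : μinf (frontier Ωinf) = 0)
    (hfrontp : ∀ p, μp p (frontier (Ωp p)) = 0)
    (hposinf : 0 < μinf Ωinf)
    (hposp : ∀ p, 0 < μp p (Ωp p))
    (hlim : Tendsto (fun M : ℕ => limsup (fun B : ℝ =>
        (Nat.card {x : Fin n → ℤ | (fun i => (x i : ℝ)) ∈ B • Ωinf ∧
          ∃ p : Nat.Primes, M < (p : ℕ) ∧ (fun i => (x i : ℤ_[(p : ℕ)])) ∉ Ωp p} : ℝ) / B ^ n)
        atTop) atTop (𝓝 0)) :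
    Multipliable (fun p : Nat.Primes => (μp p (Ωp p)).toReal / (μp p Set.univ).toReal) ∧
    Tendsto (fun B : ℝ =>
        (Nat.card {x : Fin n → ℤ | (fun i => (x i : ℝ)) ∈ B • Ωinf ∧
          ∀ p : Nat.Primes, (fun i => (x i : ℤ_[(p : ℕ)])) ∈ Ωp p} : ℝ) / B ^ n)
      atTop (𝓝 ((μinf Ωinf).toReal
          / (μinf (Set.univ.pi fun _ : Fin n => Set.Ico (0 : ℝ) 1)).toReal *
        ∏' p : Nat.Primes, (μp p (Ωp p)).toReal / (μp p Set.univ).toReal)) ∧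
    (μinf Ωinf).toReal / (μinf (Set.univ.pi fun _ : Fin n => Set.Ico (0 : ℝ) 1)).toReal *
        (∏' p : Nat.Primes, (μp p (Ωp p)).toReal / (μp p Set.univ).toReal) ≠ 0 := by
  classical
  set V : ℝ := (μinf Ωinf).toReal
    / (μinf (Set.univ.pi fun _ : Fin n => Set.Ico (0 : ℝ) 1)).toReal with hVdef
  set s : Nat.Primes → ℝ := fun p => (μp p (Ωp p)).toReal / (μp p Set.univ).toReal with hs
  have hV : 0 < V := div_pos
    (ENNReal.toReal_pos hposinf.ne' hbdd.measure_lt_top.ne) (Ekedahl.cov_pos μinf)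
  have htop : ∀ p (A : Set (Fin n → ℤ_[(p : Nat.Primes)])), μp p A ≠ ⊤ := fun p A => by
    have := hHaar p
    exact measure_ne_top _ _
  have hs0 : ∀ p, 0 < s p := fun p => div_pos
    (ENNReal.toReal_pos (hposp p).ne' (htop _ _))
    (ENNReal.toReal_pos ((hposp p).trans_le (measure_mono (Set.subset_univ _))).ne' (htop _ _))
  have hs1 : ∀ p, s p ≤ 1 := fun p => div_le_one_of_le₀
    (ENNReal.toReal_mono (htop _ _) (measure_mono (Set.subset_univ _))) ENNReal.toReal_nonneg
  let G : Finset Nat.Primes → Set (Fin n → ℤ) := fun S =>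
    {x | ∀ p ∈ S, (fun i => (x i : ℤ_[(p : ℕ)])) ∈ Ωp p}
  let A : Set (Fin n → ℤ) := {x | ∀ p : Nat.Primes, (fun i => (x i : ℤ_[(p : ℕ)])) ∈ Ωp p}
  let E : ℕ → Set (Fin n → ℤ) := fun M =>
    {x | ∃ p : Nat.Primes, M < (p : ℕ) ∧ (fun i => (x i : ℤ_[(p : ℕ)])) ∉ Ωp p}
  let c : Set (Fin n → ℤ) → ℝ → ℝ := fun T B => ((Ekedahl.cset Ωinf B T).ncard : ℝ) / B ^ n
  have hG : ∀ S, Tendsto (c (G S)) atTop (𝓝 (V * ∏ p ∈ S, s p)) := fun S =>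
    Ekedahl.finite_sieve μinf hbdd hfrontinf μp hHaar Ωp hfrontp S
  have hlim' : Tendsto (fun M : ℕ => limsup (c (E M)) atTop) atTop (𝓝 0) := hlim
  have htail : ∀ ε > 0, ∃ M : ℕ, ∀ᶠ B in atTop, c (E M) B < ε := by
    intro ε hε
    obtain ⟨M, hM⟩ := ((tendsto_order.1 hlim').2 ε hε).exists
    refine ⟨M, eventually_lt_of_limsup_lt hM ?_⟩
    refine (hG ∅).isBoundedUnder_le.mono_le ?_
    filter_upwards [eventually_gt_atTop 0] with B hB
    refine Ekedahl.cset_mono hbdd hB ?_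
    intro x _ p hp
    simp at hp
  have hanti : Antitone (fun S : Finset Nat.Primes => ∏ p ∈ S, s p) := by
    intro S T h
    change ∏ p ∈ T, s p ≤ ∏ p ∈ S, s p
    rw [← Finset.prod_sdiff h]
    exact mul_le_of_le_one_left (Finset.prod_nonneg fun p _ => (hs0 p).le)
      (Finset.prod_le_one (fun p _ => (hs0 p).le) (fun p _ => hs1 p))
  have hbelow : BddBelow (Set.range (fun S : Finset Nat.Primes => ∏ p ∈ S, s p)) := by
    refine ⟨0, ?_⟩
    rintro _ ⟨S, rfl⟩
    exact Finset.prod_nonneg fun p _ => (hs0 p).le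
  have hF : ∀ M : ℕ, {p : Nat.Primes | (p : ℕ) ≤ M}.Finite := fun M =>
    Set.Finite.preimage (Subtype.val_injective.injOn) (Set.finite_Iic M)
  set P : ℝ := ⨅ S : Finset Nat.Primes, ∏ p ∈ S, s p with hP
  have hPt : Tendsto (fun S : Finset Nat.Primes => ∏ p ∈ S, s p) atTop (𝓝 P) :=
    tendsto_atTop_ciInf hanti hbelow
  have hprod : HasProd s P := by
    simpa [HasProd] using hPt
  have hPle : ∀ S : Finset Nat.Primes, P ≤ ∏ p ∈ S, s p := fun S => ciInf_le hbelow S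
  have hPpos : 0 < P := by
    obtain ⟨M, hM⟩ := htail (V / 2) (by positivity)
    have hhalf : ∀ S : Finset Nat.Primes, (∀ p ∈ S, M < (p : ℕ)) → 1 / 2 ≤ ∏ p ∈ S, s p := by
      intro S hS
      have h1 : V * ∏ p ∈ (∅ : Finset Nat.Primes), s p ≤ V * ∏ p ∈ S, s p + V / 2 := by
        refine le_of_tendsto_of_tendsto (hG ∅) ((hG S).add_const (V / 2)) ?_
        filter_upwards [hM, eventually_gt_atTop 0] with B h1 hB
        have h2 : c (G ∅) B ≤ c (G S) B + c (E M) B := by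
          refine Ekedahl.cset_union hbdd hB ?_
          intro x _
          by_cases hx : x ∈ G S
          · exact Or.inl hx
          · right
            simp only [G, Set.mem_ofPred_eq, not_forall] at hx
            obtain ⟨p, hp, hx⟩ := hx
            exact ⟨p, hS p hp, hx⟩
        linarith
      rw [Finset.prod_empty] at h1
      nlinarith
    have hlow : (∏ p ∈ (hF M).toFinset, s p) * (1 / 2) ≤ P := by
      refine le_ciInf fun S => ?_
      rw [← Finset.prod_filter_mul_prod_filter_not S (fun p : Nat.Primes => (p : ℕ) ≤ M)]
      refine mul_le_mul ?_ (hhalf _ ?_) (by norm_num) (Finset.prod_nonneg fun p _ => (hs0 p).le)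
      · refine hanti ?_
        intro p hp
        simpa using (Finset.mem_filter.1 hp).2
      · intro p hp
        exact not_le.1 (Finset.mem_filter.1 hp).2
    refine lt_of_lt_of_le ?_ hlow
    exact mul_pos (Finset.prod_pos fun p _ => hs0 p) (by norm_num)
  refine ⟨⟨P, hprod⟩, ?_, ?_⟩
  · rw [hprod.tprod_eq]
    change Tendsto (c A) atTop (𝓝 (V * P))
    rw [tendsto_order]
    constructor
    · intro a ha
      obtain ⟨M, hM⟩ := htail ((V * P - a) / 2) (by linarith)
      have h1 : (V * P + a) / 2 < V * ∏ p ∈ (hF M).toFinset, s p := by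
        have := mul_le_mul_of_nonneg_left (hPle (hF M).toFinset) hV.le
        linarith
      filter_upwards [hM, (tendsto_order.1 (hG (hF M).toFinset)).1 _ h1,
        eventually_gt_atTop 0] with B h2 h3 hB
      have h4 : c (G (hF M).toFinset) B ≤ c A B + c (E M) B := by
        refine Ekedahl.cset_union hbdd hB ?_
        intro x hx
        by_cases hxA : x ∈ A
        · exact Or.inl hxA
        · right
          simp only [A, Set.mem_ofPred_eq, not_forall] at hxA
          obtain ⟨p, hp⟩ := hxA
          refine ⟨p, ?_, hp⟩
          by_contra hcon
          exact hp (hx p (by simpa using hcon))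
      linarith
    · intro a ha
      obtain ⟨S, hS⟩ := ((tendsto_order.1 (hPt.const_mul V)).2 a ha).exists
      filter_upwards [(tendsto_order.1 (hG S)).2 a hS, eventually_gt_atTop 0] with B h1 hB
      refine lt_of_le_of_lt (Ekedahl.cset_mono hbdd hB ?_) h1
      intro x hx p _
      exact hx p
  · rw [hprod.tprod_eq]
    exact (mul_pos hV hPpos).ne'
end

section
/- Let n ≥ 1, let Ω_∞ ⊂ ℝ^n be a bounded subset whose boundary has Lebesgue measure zero, let S be a finite set of primes, and for each p ∈ S let K_p ⊂ ℤ_p^n be a box, i.e. a Cartesian product of n closed balls of the form {x ∈ ℤ_p : |x − a|_p ≤ b} with a ∈ ℤ_p and b ∈ ℝ. Then lim_{B→∞} B^{-n}·#{x ∈ ℤ^n : x ∈ BΩ_∞ and x ∈ K_p for every p ∈ S} = μ_∞(Ω_∞) · ∏_{p ∈ S} μ_p(K_p). -/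
open MeasureTheory Filter Topology Pointwise

theorem lcb_corner_dist {n : ℕ} (M : Fin n → ℕ) (hM : ∀ i, 0 < M i) (a : Fin n → ℤ)
    {B : ℝ} (hB : 0 < B) (y : Fin n → ℝ) :
    dist (fun i => ((M i : ℝ) * (⌊(B * y i - a i) / M i⌋ : ℤ) + a i) / B) y
      ≤ (∑ i, (M i : ℝ)) / B := by
  rw [dist_pi_le_iff (by positivity)]
  intro i
  have hMi : (0 : ℝ) < M i := by exact_mod_cast hM i
  have h1 := Int.floor_le ((B * y i - a i) / M i)
  have h2 := Int.lt_floor_add_one ((B * y i - a i) / M i)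
  rw [le_div_iff₀ hMi] at h1
  rw [div_lt_iff₀ hMi] at h2
  have h3 : (M i : ℝ) ≤ ∑ i, (M i : ℝ) :=
    Finset.single_le_sum (f := fun i => (M i : ℝ)) (fun _ _ => by positivity) (Finset.mem_univ i)
  rw [Real.dist_eq, le_div_iff₀ hB, ← abs_of_pos hB, ← abs_mul, abs_of_pos hB, sub_mul,
    div_mul_cancel₀ _ hB.ne', abs_le]
  constructor <;> nlinarith

theorem lcb_cell_volume {n : ℕ} (M : Fin n → ℕ) (hM : ∀ i, 0 < M i) (a : Fin n → ℤ)
    {B : ℝ} (hB : 0 < B) (v : Fin n → ℤ) :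
    volume {y : Fin n → ℝ | (fun i => ⌊(B * y i - a i) / M i⌋) = v}
      = ENNReal.ofReal ((∏ i, (M i : ℝ)) / B ^ n) := by
  have : {y : Fin n → ℝ | (fun i => ⌊(B * y i - a i) / M i⌋) = v}
      = Set.pi Set.univ fun i => Set.Ico (((M i : ℝ) * v i + a i) / B)
          (((M i : ℝ) * (v i + 1) + a i) / B) := by
    ext y
    simp only [Set.mem_ofPred_eq, funext_iff, Set.mem_pi, Set.mem_univ, true_imp_iff, Set.mem_Ico]
    refine forall_congr' fun i => ?_
    have hMi : (0 : ℝ) < M i := by exact_mod_cast hM i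
    rw [Int.floor_eq_iff, le_div_iff₀ hMi, div_lt_iff₀ hMi, div_le_iff₀ hB, lt_div_iff₀ hB]
    constructor <;> rintro ⟨h1, h2⟩ <;> constructor <;> nlinarith
  rw [this, Real.volume_pi_Ico, ← ENNReal.ofReal_prod_of_nonneg]
  · congr 1
    have : ∀ i, (((M i : ℝ) * (v i + 1) + a i) / B) - (((M i : ℝ) * v i + a i) / B) = M i / B := by
      intro i; ring
    simp [this, Finset.prod_div_distrib]
  · intro i _
    have : (((M i : ℝ) * (v i + 1) + a i) / B) - (((M i : ℝ) * v i + a i) / B) = M i / B := by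
      ring
    rw [this]; positivity

theorem lcb_lattice {n : ℕ} (Ω : Set (Fin n → ℝ)) (hbdd : Bornology.IsBounded Ω)
    (hfront : volume (frontier Ω) = 0) (M : Fin n → ℕ) (hM : ∀ i, 0 < M i) (a : Fin n → ℤ) :
    Tendsto (fun B : ℝ =>
        (Nat.card {x : Fin n → ℤ | (fun i => (x i : ℝ)) ∈ B • Ω ∧
          ∀ i, (M i : ℤ) ∣ x i - a i} : ℝ) / B ^ n)
      atTop (𝓝 ((volume Ω).toReal / ∏ i, (M i : ℝ))) := by
  have hP : (0 : ℝ) < ∏ i, (M i : ℝ) := Finset.prod_pos fun i _ => by exact_mod_cast hM i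
  set fl : ℝ → (Fin n → ℝ) → (Fin n → ℤ) := fun B y i => ⌊(B * y i - a i) / M i⌋ with hfl
  set T : ℝ → Set (Fin n → ℤ) := fun B => {v | (fun i => ((M i : ℝ) * v i + a i) / B) ∈ Ω} with hT
  have hflm : ∀ B, Measurable (fl B) := by
    intro B
    refine measurable_pi_lambda _ fun i => ?_
    exact Int.measurable_floor.comp (by fun_prop)
  -- measure of the union of cells
  have hvol : ∀ B : ℝ, 0 < B → volume (fl B ⁻¹' T B)
      = (T B).encard * ENNReal.ofReal ((∏ i, (M i : ℝ)) / B ^ n) := by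
    intro B hB
    have : fl B ⁻¹' T B = ⋃ v : T B, fl B ⁻¹' {v.1} := by
      ext y; simp
    rw [this, measure_iUnion]
    · have : ∀ v : T B, volume (fl B ⁻¹' {v.1}) = ENNReal.ofReal ((∏ i, (M i : ℝ)) / B ^ n) :=
        fun v => lcb_cell_volume M hM a hB v.1
      simp_rw [this]
      rw [ENNReal.tsum_const]
      rfl
    · intro v w hvw
      refine Disjoint.preimage _ ?_
      simpa [Subtype.ext_iff] using hvw
    · intro v
      exact hflm B (MeasurableSet.singleton _)
  have hcard : ∀ B : ℝ, 0 < B →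
      Nat.card {x : Fin n → ℤ | (fun i => (x i : ℝ)) ∈ B • Ω ∧ ∀ i, (M i : ℤ) ∣ x i - a i}
        = Nat.card (T B) := by
    intro B hB
    symm
    refine Nat.card_congr (Equiv.ofBijective
      (fun v => ⟨fun i => M i * v.1 i + a i, ?_, ?_⟩) ⟨?_, ?_⟩)
    · rw [Set.mem_smul_set_iff_inv_smul_mem₀ hB.ne']
      have h := v.2
      have e : (B⁻¹ • fun i => (((M i : ℤ) * v.1 i + a i : ℤ) : ℝ))
          = fun i => ((M i : ℝ) * v.1 i + a i) / B := by
        ext i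
        simp [div_eq_inv_mul]
      rw [e]
      exact h
    · intro i; simp
    · intro v w h
      ext i
      have := congrFun (congrArg Subtype.val h) i
      have hMi : (M i : ℤ) ≠ 0 := by exact_mod_cast (hM i).ne'
      simpa [hMi, (hM i).ne'] using this
    · rintro ⟨x, hx, hx'⟩
      have hx2 : ∀ i, ∃ c, x i - a i = M i * c := hx'
      choose v hv using hx2
      have hv' : ∀ i, x i = M i * v i + a i := fun i => by linarith [hv i]
      refine ⟨⟨v, ?_⟩, ?_⟩
      · rw [Set.mem_smul_set_iff_inv_smul_mem₀ hB.ne'] at hx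
        have e : (B⁻¹ • fun i => (x i : ℝ)) = fun i => ((M i : ℝ) * v i + a i) / B := by
          ext i
          simp [div_eq_inv_mul, hv' i]
        rw [e] at hx
        exact hx
      · ext i; simp [hv' i]
  have hinterior : volume (interior Ω) = volume Ω := by
    refine le_antisymm (measure_mono interior_subset) ?_
    calc volume Ω ≤ volume (interior Ω ∪ frontier Ω) := by
          refine measure_mono ?_
          rw [← closure_eq_interior_union_frontier]; exact subset_closure
      _ ≤ _ := measure_union_le _ _
      _ = _ := by rw [hfront, add_zero]
  have hdist : Tendsto (fun B : ℝ => (∑ i, (M i : ℝ)) / B) atTop (𝓝 0) :=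
    tendsto_const_nhds.div_atTop tendsto_id
  have hcorner : ∀ y : Fin n → ℝ, Tendsto (fun B : ℝ => fun i =>
      ((M i : ℝ) * (fl B y i) + a i) / B) atTop (𝓝 y) := by
    intro y
    rw [tendsto_iff_dist_tendsto_zero]
    refine squeeze_zero' (Eventually.of_forall fun _ => dist_nonneg) ?_ hdist
    filter_upwards [eventually_gt_atTop 0] with B hB
    exact lcb_corner_dist M hM a hB y
  obtain ⟨R, hR⟩ := hbdd.subset_closedBall 0
  have key : Tendsto (fun B : ℝ => volume (fl B ⁻¹' T B)) atTop (𝓝 (volume (interior Ω))) := by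
    refine tendsto_measure_of_ae_tendsto_indicator (B := Metric.closedBall 0 (R + 1)) atTop
      isOpen_interior.measurableSet (fun B => hflm B (Set.to_countable _).measurableSet)
      Metric.isClosed_closedBall.measurableSet (measure_closedBall_lt_top).ne ?_ ?_
    · filter_upwards [eventually_gt_atTop 0, hdist.eventually_le_const zero_lt_one] with B hB hB1
      intro y hy
      have h1 := hR hy
      have h2 := (lcb_corner_dist M hM a hB y).trans hB1
      rw [Metric.mem_closedBall] at h1 ⊢
      rw [dist_comm] at h2
      refine (dist_triangle _ _ _).trans ((add_le_add h2 h1).trans (by linarith))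
    · have : ∀ᵐ y ∂(volume : Measure (Fin n → ℝ)), y ∉ frontier Ω := by
        rw [ae_iff]; simpa using hfront
      filter_upwards [this] with y hy
      by_cases hyi : y ∈ interior Ω
      · filter_upwards [(hcorner y).eventually (isOpen_interior.mem_nhds hyi)] with B hB
        simp only [hyi, iff_true]
        exact interior_subset (s := Ω) hB
      · have hyc : y ∈ (closure Ω)ᶜ := fun h => hy ⟨h, hyi⟩
        filter_upwards [(hcorner y).eventually
          (isClosed_closure.isOpen_compl.mem_nhds hyc)] with B hB
        simp only [hyi, iff_false]
        exact fun h => hB (subset_closure h)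
  rw [hinterior] at key
  have hfin : volume Ω ≠ ⊤ := hbdd.measure_lt_top.ne
  have key2 := ((ENNReal.tendsto_toReal hfin).comp key).div_const (∏ i, (M i : ℝ))
  refine key2.congr' ?_
  filter_upwards [eventually_gt_atTop 0] with B hB
  simp only [Function.comp]
  rw [hvol B hB, hcard B hB, ENNReal.toReal_mul, ENNReal.toReal_ofReal (by positivity)]
  have : ((((T B).encard : ENat) : ENNReal)).toReal = (Nat.card (T B) : ℝ) := by
    rw [Nat.card_coe_set_eq, Set.ncard_def]
    cases (T B).encard <;> simp
  rw [this]
  field_simp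

theorem lcb_radius {p : ℕ} [Fact p.Prime] {b : ℝ} (hb : 0 < b) :
    ∃ k : ℕ, ∀ x : ℤ_[p], ‖x‖ ≤ b ↔ PadicInt.toZModPow k x = 0 := by
  classical
  have hp1 : (1 : ℝ) < p := by exact_mod_cast (Fact.out : p.Prime).one_lt
  have hex : ∃ k : ℕ, (p : ℝ) ^ (-k : ℤ) ≤ b := by
    obtain ⟨k, hk⟩ := exists_pow_lt_of_lt_one hb (inv_lt_one_of_one_lt₀ hp1)
    exact ⟨k, by simpa using hk.le⟩
  refine ⟨Nat.find hex, fun x => ?_⟩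
  rw [← RingHom.mem_ker, PadicInt.ker_toZModPow, ← PadicInt.norm_le_pow_iff_mem_span_pow]
  refine ⟨fun h => ?_, fun h => h.trans (Nat.find_spec hex)⟩
  by_cases hx : x = 0
  · subst hx; rw [norm_zero]; positivity
  · rw [PadicInt.norm_eq_zpow_neg_valuation hx] at h ⊢
    have := Nat.find_min' hex h
    exact zpow_le_zpow_right₀ hp1.le (by lia)

theorem lcb_haar {p : ℕ} [Fact p.Prime] {n : ℕ} (μ : Measure (Fin n → ℤ_[p]))
    (hH : μ.IsAddHaarMeasure) (hm : μ Set.univ = 1) (k : Fin n → ℕ) (a : Fin n → ℤ_[p]) :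
    (μ {x | ∀ i, PadicInt.toZModPow (k i) (x i - a i) = 0}).toReal
      = 1 / ∏ i, ((p ^ k i : ℕ) : ℝ) := by
  have hp := (Fact.out : p.Prime)
  have : ∀ i, NeZero (p ^ k i) := fun i => ⟨(pow_pos hp.pos _).ne'⟩
  let f : (Fin n → ℤ_[p]) →+ (∀ i, ZMod (p ^ k i)) :=
    AddMonoidHom.pi fun i => (PadicInt.toZModPow (k i)).toAddMonoidHom.comp (Pi.evalAddMonoidHom _ i)
  have hf : ∀ x i, f x i = PadicInt.toZModPow (k i) (x i) := fun _ _ => rfl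
  have hsurj : Function.Surjective f := by
    intro y
    refine ⟨fun i => ((y i).val : ℤ_[p]), ?_⟩
    ext i
    rw [hf, map_natCast, ZMod.natCast_zmod_val]
  have hidx : f.ker.index = ∏ i, p ^ k i := by
    rw [AddSubgroup.index_ker, AddMonoidHom.range_eq_top.mpr hsurj]
    simp
  have hker : (f.ker : Set (Fin n → ℤ_[p])) = {x | ∀ i, ‖x i‖ ≤ (p : ℝ) ^ (-(k i) : ℤ)} := by
    ext x
    simp only [SetLike.mem_coe, AddMonoidHom.mem_ker, funext_iff, hf, Set.mem_ofPred_eq]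
    refine forall_congr' fun i => ?_
    rw [PadicInt.norm_le_pow_iff_mem_span_pow, ← PadicInt.ker_toZModPow, RingHom.mem_ker]
    rfl
  have hmeas : MeasurableSet (f.ker : Set (Fin n → ℤ_[p])) := by
    rw [hker, Set.ofPred_forall]
    refine MeasurableSet.iInter fun i => ?_
    have : MeasurableSet {x : ℤ_[p] | ‖x‖ ≤ (p : ℝ) ^ (-(k i) : ℤ)} :=
      (isClosed_le continuous_norm continuous_const).measurableSet
    exact this.preimage (measurable_pi_apply (X := fun _ : Fin n => ℤ_[p]) i)
  have hne : f.ker.index ≠ 0 := by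
    rw [hidx]; exact Finset.prod_ne_zero_iff.mpr fun i _ => (this i).out
  have : f.ker.FiniteIndex := ⟨hne⟩
  have h1 := MeasureTheory.AddSubgroup.index_mul_measure f.ker hmeas μ
  have h2 : {x : Fin n → ℤ_[p] | ∀ i, PadicInt.toZModPow (k i) (x i - a i) = 0}
      = (fun x => (-a) + x) ⁻¹' (f.ker : Set (Fin n → ℤ_[p])) := by
    ext x
    simp only [Set.mem_ofPred_eq, Set.mem_preimage, SetLike.mem_coe, AddMonoidHom.mem_ker,
      funext_iff, hf]
    refine forall_congr' fun i => ?_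
    rw [Pi.add_apply, Pi.neg_apply, neg_add_eq_sub]
    rfl
  rw [h2, measure_preimage_add]
  have h3 := congrArg ENNReal.toReal h1
  rw [hm, ENNReal.toReal_mul, ENNReal.toReal_natCast, hidx] at h3
  simp only [ENNReal.toReal_one] at h3
  rw [Nat.cast_prod] at h3
  rw [eq_div_iff, mul_comm, h3]
  rw [← Nat.cast_prod, ← hidx]
  exact_mod_cast hne

/-- integer points in a residue class. -/
theorem lcb_int {p : ℕ} [Fact p.Prime] (k : ℕ) (a : ℤ_[p]) (x : ℤ) :
    PadicInt.toZModPow k ((x : ℤ_[p]) - a) = 0 ↔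
      ((p ^ k : ℕ) : ℤ) ∣ x - ((PadicInt.toZModPow k a).val : ℕ) := by
  have : NeZero (p ^ k) := ⟨(pow_pos (Fact.out : p.Prime).pos _).ne'⟩
  rw [← ZMod.intCast_zmod_eq_zero_iff_dvd, map_sub, map_intCast, Int.cast_sub, Int.cast_natCast,
    ZMod.natCast_zmod_val]

theorem lcb_crt (S : Finset Nat.Primes) (k A : Nat.Primes → ℕ) :
    ∃ c : ℤ, ∀ x : ℤ, (∀ p ∈ S, (((p : ℕ) ^ k p : ℕ) : ℤ) ∣ x - A p) ↔
      ((∏ p ∈ S, (p : ℕ) ^ k p : ℕ) : ℤ) ∣ x - c := by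
  have hco : ∀ p q : Nat.Primes, p ≠ q → Nat.Coprime ((p : ℕ) ^ k p) ((q : ℕ) ^ k q) := by
    intro p q h
    refine Nat.Coprime.pow _ _ ((Nat.coprime_primes p.2 q.2).mpr ?_)
    exact fun h' => h (Subtype.ext h')
  obtain ⟨c, hc⟩ := Nat.chineseRemainderOfFinset A (fun p : Nat.Primes => (p : ℕ) ^ k p) S
    (fun p _ => (pow_pos p.2.pos _).ne') (fun p _ q _ h => hco p q h)
  refine ⟨c, fun x => ?_⟩
  have hc' : ∀ p ∈ S, ((((p : ℕ) ^ k p : ℕ) : ℤ) ∣ x - A p ↔ (((p : ℕ) ^ k p : ℕ) : ℤ) ∣ x - c) := by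
    intro p hp
    have h := (Nat.modEq_iff_dvd.mp (hc p hp))
    constructor
    · intro h'
      have := dvd_add h' h
      simpa using this
    · intro h'
      have := dvd_sub h' h
      simpa using this
  constructor
  · intro h
    rw [Nat.cast_prod]
    refine Finset.prod_dvd_of_coprime (fun p _ q _ hpq => ?_) fun p hp => (hc' p hp).mp (h p hp)
    exact Nat.isCoprime_iff_coprime.mpr (hco p q hpq)
  · intro h p hp
    refine (hc' p hp).mpr (dvd_trans ?_ h)
    exact Int.natCast_dvd_natCast.mpr (Finset.dvd_prod_of_mem _ hp)

theorem lcb_finite {n : ℕ} (Ω : Set (Fin n → ℝ)) (hbdd : Bornology.IsBounded Ω) (B : ℝ) :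
    {x : Fin n → ℤ | (fun i => (x i : ℝ)) ∈ B • Ω}.Finite := by
  obtain ⟨R, hR⟩ := (hbdd.smul₀ B).subset_closedBall 0
  refine (Set.finite_Icc (fun _ => -⌈R⌉) (fun _ => ⌈R⌉)).subset ?_
  intro x hx
  have h := hR hx
  rw [mem_closedBall_zero_iff] at h
  have h' : ∀ i, |(x i : ℝ)| ≤ R := fun i => (norm_le_pi_norm (fun i => (x i : ℝ)) i).trans h
  refine ⟨fun i => ?_, fun i => ?_⟩
  · have := (abs_le.mp (h' i)).1
    have h4 := Int.le_ceil R
    have : (-⌈R⌉ : ℝ) ≤ x i := by linarith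
    exact_mod_cast this
  · have := (abs_le.mp (h' i)).2
    have h4 := Int.le_ceil R
    have : (x i : ℝ) ≤ ⌈R⌉ := by linarith
    exact_mod_cast this

theorem lcb_sub {p : ℕ} [Fact p.Prime] {n : ℕ} (a : Fin n → ℤ_[p]) (b : Fin n → ℝ) (i₀ : Fin n)
    (hb : b i₀ ≤ 0) (k : ℕ) (x : Fin n → ℤ_[p]) (hx : ∀ i, ‖x i - a i‖ ≤ b i) (i : Fin n) :
    PadicInt.toZModPow (if i = i₀ then k else 0) (x i - a i) = 0 := by
  rw [← RingHom.mem_ker, PadicInt.ker_toZModPow, ← PadicInt.norm_le_pow_iff_mem_span_pow]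
  by_cases h : i = i₀
  · subst h
    exact (hx i).trans (hb.trans (by positivity))
  · simpa [h] using PadicInt.norm_le_one _

/-- Lattice point counting with finitely many `p`-adic box conditions: if `Ω_∞ ⊂ ℝⁿ` is
bounded with boundary of Lebesgue measure zero, `S` is a finite set of primes, and for each
`p ∈ S` the set `K_p ⊂ ℤ_pⁿ` is a box (a product of closed balls), then
`lim_{B→∞} B⁻ⁿ·#{x ∈ ℤⁿ : x ∈ BΩ_∞, x ∈ K_p for all p ∈ S} = μ_∞(Ω_∞)·∏_{p ∈ S} μ_p(K_p)`,
where `μp p` is the Haar probability measure on `ℤ_pⁿ`. -/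
theorem lattice_count_with_box_conditions (n : ℕ) (hn : 1 ≤ n)
    (Ωinf : Set (Fin n → ℝ)) (hbdd : Bornology.IsBounded Ωinf)
    (hfront : volume (frontier Ωinf) = 0)
    (S : Finset Nat.Primes)
    (K : ∀ p : Nat.Primes, Set (Fin n → ℤ_[(p : ℕ)]))
    (hbox : ∀ p ∈ S, ∃ (a : Fin n → ℤ_[(p : ℕ)]) (b : Fin n → ℝ),
      K p = {x | ∀ i, ‖x i - a i‖ ≤ b i})
    (μp : ∀ p : Nat.Primes, Measure (Fin n → ℤ_[(p : ℕ)]))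
    (hHaar : ∀ p, (μp p).IsAddHaarMeasure) (hmass : ∀ p, μp p Set.univ = 1) :
    Tendsto (fun B : ℝ =>
        (Nat.card {x : Fin n → ℤ | (fun i => (x i : ℝ)) ∈ B • Ωinf ∧
          ∀ p ∈ S, (fun i => (x i : ℤ_[(p : ℕ)])) ∈ K p} : ℝ) / B ^ n)
      atTop (𝓝 ((volume Ωinf).toReal * ∏ p ∈ S, (μp p (K p)).toReal)) := by
  have hbox' : ∀ p : Nat.Primes, ∃ (a : Fin n → ℤ_[(p : ℕ)]) (b : Fin n → ℝ),
      p ∈ S → K p = {x | ∀ i, ‖x i - a i‖ ≤ b i} := by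
    intro p
    by_cases hp : p ∈ S
    · obtain ⟨a, b, h⟩ := hbox p hp
      exact ⟨a, b, fun _ => h⟩
    · exact ⟨0, 0, fun h => absurd h hp⟩
  choose a b hK using hbox'
  have hKm : ∀ p ∈ S, ∀ x, x ∈ K p ↔ ∀ i, ‖x i - a p i‖ ≤ b p i := by
    intro p hp x
    rw [hK p hp]; rfl
  by_cases hpos : ∀ p ∈ S, ∀ i, 0 < b p i
  · have hk : ∀ (p : Nat.Primes) (i : Fin n), ∃ k : ℕ, p ∈ S →
        ∀ x : ℤ_[(p : ℕ)], ‖x‖ ≤ b p i ↔ PadicInt.toZModPow k x = 0 := by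
      intro p i
      by_cases hp : p ∈ S
      · obtain ⟨k, h⟩ := lcb_radius (p := (p : ℕ)) (hpos p hp i)
        exact ⟨k, fun _ => h⟩
      · exact ⟨0, fun h => absurd h hp⟩
    choose k hk using hk
    choose c hc using fun i : Fin n => lcb_crt S (fun p => k p i)
      (fun p => (PadicInt.toZModPow (k p i) (a p i)).val)
    have main := lcb_lattice Ωinf hbdd hfront (fun i => ∏ p ∈ S, (p : ℕ) ^ k p i)
      (fun i => Finset.prod_pos fun p _ => pow_pos p.2.pos _) c
    have hμ : ∏ p ∈ S, (μp p (K p)).toReal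
        = 1 / ∏ i, ((∏ p ∈ S, (p : ℕ) ^ k p i : ℕ) : ℝ) := by
      have : ∀ p ∈ S, (μp p (K p)).toReal = 1 / ∏ i, (((p : ℕ) ^ k p i : ℕ) : ℝ) := by
        intro p hp
        rw [← lcb_haar (μp p) (hHaar p) (hmass p) (k p) (a p)]
        congr 2
        ext x
        rw [hKm p hp]
        exact forall_congr' fun i => hk p i hp _
      rw [Finset.prod_congr rfl this, Finset.prod_div_distrib, Finset.prod_const_one,
        Finset.prod_comm]
      simp only [Nat.cast_prod]
    rw [hμ, mul_one_div]
    refine main.congr fun B => ?_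
    congr 3
    have : {x : Fin n → ℤ | (fun i => (x i : ℝ)) ∈ B • Ωinf ∧
          ∀ i, ((∏ p ∈ S, (p : ℕ) ^ k p i : ℕ) : ℤ) ∣ x i - c i}
        = {x : Fin n → ℤ | (fun i => (x i : ℝ)) ∈ B • Ωinf ∧
          ∀ p ∈ S, (fun i => (x i : ℤ_[(p : ℕ)])) ∈ K p} := by
      ext x
      refine and_congr_right fun _ => ?_
      have h1 : (∀ p ∈ S, (fun i => (x i : ℤ_[(p : ℕ)])) ∈ K p) ↔
          ∀ p ∈ S, ∀ i, (((p : ℕ) ^ k p i : ℕ) : ℤ) ∣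
            x i - ((PadicInt.toZModPow (k p i) (a p i)).val : ℕ) := by
        refine forall₂_congr fun p hp => ?_
        rw [hKm p hp]
        refine forall_congr' fun i => ?_
        rw [hk p i hp, lcb_int]
      rw [h1]
      constructor
      · intro h p hp i
        exact (hc i (x i)).mpr (h i) p hp
      · intro h i
        exact (hc i (x i)).mp fun p hp => h p hp i
    rw [this]
  · push Not at hpos
    obtain ⟨p, hp, i₀, hb⟩ := hpos
    have hp1 : (1 : ℝ) < (p : ℕ) := by exact_mod_cast p.2.one_lt
    have hprod : ∀ k : ℕ, ∏ i : Fin n, (((p : ℕ) ^ (if i = i₀ then k else 0) : ℕ) : ℝ)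
        = ((p : ℕ) : ℝ) ^ k := by
      intro k
      rw [Finset.prod_eq_single i₀] <;> simp +contextual
    have hlim : ∀ C : ℝ, Tendsto (fun k : ℕ => C / ((p : ℕ) : ℝ) ^ k) atTop (𝓝 0) := fun C =>
      tendsto_const_nhds.div_atTop (tendsto_pow_atTop_atTop_of_one_lt hp1)
    have hzero : (μp p (K p)).toReal = 0 := by
      refine le_antisymm (ge_of_tendsto' (hlim 1) fun k => ?_) ENNReal.toReal_nonneg
      rw [← hprod k, ← lcb_haar (μp p) (hHaar p) (hmass p) _ (a p)]
      refine ENNReal.toReal_mono ?_ (measure_mono ?_)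
      · exact ((measure_mono (Set.subset_univ _)).trans_lt (by simp [hmass p])).ne
      · intro x hx
        exact lcb_sub (a p) (b p) i₀ hb k x ((hKm p hp x).mp hx)
    rw [Finset.prod_eq_zero hp hzero, mul_zero, tendsto_order]
    constructor
    · intro e he
      filter_upwards [eventually_gt_atTop 0] with B hB
      exact he.trans_le (by positivity)
    · intro e he
      obtain ⟨k, hk⟩ := ((hlim (volume Ωinf).toReal).eventually_lt_const he).exists
      have main := lcb_lattice Ωinf hbdd hfront
        (fun i => (p : ℕ) ^ (if i = i₀ then k else 0)) (fun i => pow_pos p.2.pos _)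
        (fun i => ((PadicInt.toZModPow (if i = i₀ then k else 0) (a p i)).val : ℕ))
      rw [hprod k] at main
      filter_upwards [eventually_gt_atTop 0, main.eventually_lt_const hk] with B hB hlt
      refine lt_of_le_of_lt ?_ hlt
      have hcard := Nat.card_mono (s := {x : Fin n → ℤ | (fun i => (x i : ℝ)) ∈ B • Ωinf ∧
          ∀ p ∈ S, (fun i => (x i : ℤ_[(p : ℕ)])) ∈ K p})
        (t := {x : Fin n → ℤ | (fun i => (x i : ℝ)) ∈ B • Ωinf ∧
          ∀ i, (((p : ℕ) ^ (if i = i₀ then k else 0) : ℕ) : ℤ) ∣ x i -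
            ((PadicInt.toZModPow (if i = i₀ then k else 0) (a p i)).val : ℕ)})
        ((lcb_finite Ωinf hbdd B).subset fun x hx => hx.1)
        (fun x hx => ⟨hx.1, fun i => (lcb_int _ _ _).mp
          (lcb_sub (a p) (b p) i₀ hb k _ ((hKm p hp _).mp (hx.2 p hp)) i)⟩)
      gcongr
end

section
/- Let k be a number field of degree d over ℚ. Let Ω_∞ ⊂ k_∞^n be a bounded subset and for each nonzero prime ideal 𝔭 of 𝔬 let Ω_𝔭 ⊂ 𝔬_𝔭^n. Assume: (1) μ_∞(∂Ω_∞) = 0 and μ_𝔭(∂Ω_𝔭) = 0 for every 𝔭; (2) μ_∞(Ω_∞) > 0 and μ_𝔭(Ω_𝔭) > 0 for every 𝔭; (3) lim_{M→∞} limsup_{B→∞} B^{-dn}·#{x ∈ 𝔬^n : x ∈ BΩ_∞ and there exists a prime 𝔭 with N𝔭 > M and x ∉ Ω_𝔭} = 0. Then the limit lim_{B→∞} B^{-dn}·#{x ∈ 𝔬^n : x ∈ BΩ_∞ and x ∈ Ω_𝔭 for all primes 𝔭} exists, is nonzero, and equals |Δ_k|^{-n/2} · μ_∞(Ω_∞)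 · ∏_𝔭 μ_𝔭(Ω_𝔭). -/
open MeasureTheory Filter Topology Pointwise NumberField IsDedekindDomain

noncomputable instance {K : Type*} [Field K] [NumberField K]
    (v : HeightOneSpectrum (𝓞 K)) :
    MeasurableSpace (v.adicCompletionIntegers K) := borel _

instance {K : Type*} [Field K] [NumberField K] (v : HeightOneSpectrum (𝓞 K)) :
    BorelSpace (v.adicCompletionIntegers K) := ⟨rfl⟩

noncomputable instance (priority := 5000) {K : Type*} [Field K] [NumberField K]
    (v : HeightOneSpectrum (𝓞 K)) : Algebra (𝓞 K) (v.adicCompletionIntegers K) :=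
  IsDedekindDomain.HeightOneSpectrum.instAlgebraSubtypeAdicCompletionMemValuationSubringAdicCompletionIntegers (𝓞 K) K v


lemma aux_exists_floor (k : Type*) [Field k] [NumberField k]
    (d : ℕ) (hd : d = Module.finrank ℚ k)
    (ι : 𝓞 k →ₗ[ℤ] (Fin d → ℝ)) (hinj : Function.Injective ι)
    (hspan : Submodule.span ℝ (Set.range ι) = ⊤)
    (μ : Measure (Fin d → ℝ)) [μ.IsAddHaarMeasure] :
    ∃ fl : (Fin d → ℝ) → 𝓞 k, ∃ R : ℝ, (∀ y, ‖ι (fl y) - y‖ ≤ R) ∧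
      ∀ l, MeasurableSet (fl ⁻¹' {l}) ∧
        μ (fl ⁻¹' {l}) = ENNReal.ofReal (ZLattice.covolume (LinearMap.range ι) μ) ∧
        0 < ZLattice.covolume (LinearMap.range ι) μ := by
  classical
  have hcard : Fintype.card (Module.Free.ChooseBasisIndex ℤ (𝓞 k)) = d := by
    rw [← Module.finrank_eq_card_chooseBasisIndex, RingOfIntegers.rank, hd]
  let b0 := RingOfIntegers.basis k
  have hrange : LinearMap.range ι = Submodule.span ℤ (Set.range (ι ∘ b0)) := by
    rw [Set.range_comp, ← Submodule.map_span, b0.span_eq, Submodule.map_top]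
  have hsp : (⊤ : Submodule ℝ (Fin d → ℝ)) ≤ Submodule.span ℝ (Set.range (ι ∘ b0)) := by
    rw [← hspan, Submodule.span_le]
    have : Set.range ι = (LinearMap.range ι : Set (Fin d → ℝ)) := (LinearMap.coe_range ι).symm
    rw [this, hrange]
    exact Submodule.span_subset_span ℤ ℝ _
  let b : Module.Basis _ ℝ (Fin d → ℝ) :=
    basisOfTopLeSpanOfCardEqFinrank (ι ∘ b0) hsp (by simp [hcard])
  have hb : ⇑b = ι ∘ b0 := coe_basisOfTopLeSpanOfCardEqFinrank _ _ _
  have hL : LinearMap.range ι = Submodule.span ℤ (Set.range b) := by rw [hb, hrange]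
  have hcov : ZLattice.covolume (LinearMap.range ι) μ = μ.real (ZSpan.fundamentalDomain b) := by
    rw [hL]
    exact ZLattice.covolume_eq_measure_fundamentalDomain _ _ (ZSpan.isAddFundamentalDomain b μ)
  have hpos : 0 < ZLattice.covolume (LinearMap.range ι) μ := by
    rw [hL]; exact ZLattice.covolume_pos _ _
  have hex : ∀ y, ∃ a : 𝓞 k, ι a = ZSpan.floor b y := by
    intro y
    have : (ZSpan.floor b y : Fin d → ℝ) ∈ LinearMap.range ι := by
      rw [hL]; exact (ZSpan.floor b y).2
    exact this
  choose fl hfl using hex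
  refine ⟨fl, ∑ i, ‖b i‖, ?_, ?_⟩
  · intro y
    rw [hfl, ← neg_sub, norm_neg]
    exact ZSpan.norm_fract_le b y
  · intro l
    have hl : ι l ∈ Submodule.span ℤ (Set.range b) := by rw [← hL]; exact ⟨l, rfl⟩
    have hpre : fl ⁻¹' {l} = (fun y => y + -ι l) ⁻¹' ZSpan.fundamentalDomain b := by
      ext y
      simp only [Set.mem_preimage, Set.mem_singleton_iff]
      constructor
      · intro h
        have := ZSpan.fract_mem_fundamentalDomain b y
        rwa [ZSpan.fract_apply, ← hfl, h, sub_eq_add_neg] at this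
      · intro h
        have h1 := (ZSpan.fract_eq_self (b := b)).2 h
        rw [ZSpan.fract_add_ZSpan b y (Submodule.neg_mem _ hl), ZSpan.fract_apply, ← hfl] at h1
        apply hinj
        have : y - ι (fl y) = y - ι l := by rw [h1, sub_eq_add_neg]
        simpa using this
    refine ⟨?_, ?_, hpos⟩
    · rw [hpre]
      exact (ZSpan.fundamentalDomain_measurableSet b).preimage (measurable_add_const _)
    · rw [hpre, measure_preimage_add_right, hcov, Measure.real, ENNReal.ofReal_toReal]
      exact (ZSpan.fundamentalDomain_isBounded b).measure_lt_top.ne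

/-- Counting in one residue class. -/
lemma aux_count_class {E Λ Q : Type*} [NormedAddCommGroup E] [NormedSpace ℝ E]
    [FiniteDimensional ℝ E] [MeasurableSpace E] [BorelSpace E] (μ : Measure E)
    [μ.IsAddHaarMeasure] [AddCommGroup Λ] [Countable Λ] (J : Λ →+ E) (fl : E → Λ) (R : ℝ)
    (hR : ∀ y, ‖J (fl y) - y‖ ≤ R) (c : ℝ) (hc : 0 < c)
    (hfl : ∀ l, MeasurableSet (fl ⁻¹' {l}) ∧ μ (fl ⁻¹' {l}) = ENNReal.ofReal c)
    [AddCommGroup Q] [Finite Q] (φ : Λ →+ Q) (hφ : Function.Surjective φ) (t : Q)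
    (A : Set E) (hA : Bornology.IsBounded A) (hfr : μ (frontier A) = 0) :
    (∀ B : ℝ, 0 < B → {x : Λ | J x ∈ B • A ∧ φ x = t}.Finite) ∧
    Tendsto (fun B : ℝ => (Nat.card {x : Λ | J x ∈ B • A ∧ φ x = t} : ℝ)
      / B ^ (Module.finrank ℝ E)) atTop (𝓝 ((μ A).toReal / (c * Nat.card Q))) := by
  classical
  obtain ⟨r, hr⟩ : ∃ r : Q → Λ, ∀ q, φ (r q) = q := ⟨_, Function.rightInverse_surjInv hφ⟩
  set s : Λ → Λ := fun l => l - r (φ l) + r t with hs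
  have hsφ : ∀ l, φ (s l) = t := by intro l; simp [hs, hr]
  -- bounded displacement
  obtain ⟨R', hR'⟩ : ∃ R' : ℝ, ∀ q, ‖J (r t) - J (r q)‖ ≤ R' := by
    obtain ⟨M, hM⟩ := (Set.finite_range (fun q => ‖J (r t) - J (r q)‖)).bddAbove
    exact ⟨M, fun q => hM ⟨q, rfl⟩⟩
  have hdisp : ∀ y, ‖J (s (fl y)) - y‖ ≤ R + R' := by
    intro y
    have : J (s (fl y)) - y = (J (fl y) - y) + (J (r t) - J (r (φ (fl y)))) := by
      simp [hs]; abel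
    rw [this]
    exact (norm_add_le _ _).trans (add_le_add (hR y) (hR' _))
  let N : ℝ → Set Λ := fun B => {x : Λ | J x ∈ B • A ∧ φ x = t}
  let P : ℝ → Set Λ := fun B => {l : Λ | J (s l) ∈ B • A}
  let e : ∀ B, P B ≃ N B × Q := fun B =>
    { toFun := fun l => (⟨s l, l.2, hsφ l⟩, φ l)
      invFun := fun p => ⟨p.1.1 - r t + r p.2, by
        have h1 := p.1.2.2
        have : s (p.1.1 - r t + r p.2) = p.1.1 := by
          simp [hs, hr, h1]
        show J (s (p.1.1 - r t + r p.2)) ∈ B • A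
        rw [this]; exact p.1.2.1⟩
      left_inv := by
        rintro ⟨l, hl⟩
        simp [hs]
      right_inv := by
        rintro ⟨⟨x, hx1, hx2⟩, q⟩
        ext <;> simp [hs, hr, hx2] }
  let U : ℝ → Set E := fun B => {y | J (s (fl y)) ∈ B • A}
  have hU : ∀ B, U B = ⋃ l ∈ P B, fl ⁻¹' {l} := by
    intro B; ext y; simp [U, P]
  have hUm : ∀ B, MeasurableSet (U B) := by
    intro B; rw [hU]
    exact MeasurableSet.biUnion (Set.to_countable _) (fun l _ => (hfl l).1)
  have hUμ : ∀ B, μ (U B) = (P B).encard * ENNReal.ofReal c := by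
    intro B
    rw [hU, measure_biUnion (Set.to_countable _) ?_ (fun l _ => (hfl l).1)]
    · simp_rw [(hfl _).2]
      rw [ENNReal.tsum_const]
      rw [ENat.card_coe_set_eq]
    · intro a _ b _ hab
      exact Disjoint.preimage _ (by simpa using hab)
  have hUfin : ∀ B, μ (U B) < ⊤ := by
    intro B
    apply Bornology.IsBounded.measure_lt_top
    have hBA : Bornology.IsBounded (B • A) := hA.smul₀ B
    obtain ⟨C, hC⟩ := hBA.exists_norm_le
    refine isBounded_iff_forall_norm_le.2 ⟨C + (R + R'), fun y hy => ?_⟩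
    have h1 := hC _ hy
    have h2 := hdisp y
    calc ‖y‖ = ‖J (s (fl y)) - (J (s (fl y)) - y)‖ := by congr 1; abel
      _ ≤ _ := (norm_sub_le _ _).trans (add_le_add h1 h2)
  have hPfin : ∀ B, (P B).Finite := by
    intro B
    by_contra h
    have h3 := hUfin B
    rw [hUμ, Set.encard_eq_top_iff.2 h] at h3
    simp [hc] at h3
  have hNfin : ∀ B, (N B).Finite := by
    intro B
    have : Finite (P B) := hPfin B
    have : Finite (N B × Q) := Finite.of_equiv _ (e B)
    have : Finite (N B) := Finite.of_surjective (Prod.fst : N B × Q → N B)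
      (fun x => ⟨(x, 0), rfl⟩)
    exact this
  refine ⟨fun B _ => hNfin B, ?_⟩
  have hcardQ : (0 : ℝ) < Nat.card Q := by exact_mod_cast Nat.card_pos
  have hUreal : ∀ B, (μ (U B)).toReal = Nat.card (N B) * (c * Nat.card Q) := by
    intro B
    have h1 : (P B).encard = (Nat.card (P B) : ℕ∞) := by
      rw [(hPfin B).encard_eq_coe_toFinset_card, Nat.card_coe_set_eq,
        Set.ncard_eq_toFinset_card _ (hPfin B)]
    rw [hUμ, h1, Nat.card_congr (e B), Nat.card_prod]
    simp [hc.le]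
    ring
  -- rescale
  set D := Module.finrank ℝ E with hD
  let V : ℝ → Set E := fun B => (fun y => B • y) ⁻¹' (U B)
  have hVμ : ∀ B, 0 < B → (μ (V B)).toReal = (μ (U B)).toReal / B ^ D := by
    intro B hB
    have := Measure.addHaar_preimage_smul μ hB.ne' (U B)
    simp only [V]
    rw [this, ENNReal.toReal_mul, ENNReal.toReal_ofReal (abs_nonneg _), abs_of_pos (by positivity)]
    ring
  have hae : μ A = μ (interior A) := by
    refine le_antisymm ?_ (measure_mono interior_subset)
    calc μ A ≤ μ (interior A ∪ frontier A) := measure_mono (by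
            rw [← closure_eq_interior_union_frontier]; exact subset_closure)
      _ ≤ μ (interior A) + μ (frontier A) := measure_union_le _ _
      _ = μ (interior A) := by rw [hfr, add_zero]
  obtain ⟨C, hC⟩ := hA.exists_norm_le
  have hconv : ∀ y, Tendsto (fun B : ℝ => B⁻¹ • J (s (fl (B • y)))) atTop (𝓝 y) := by
    intro y
    rw [tendsto_iff_norm_sub_tendsto_zero]
    have hz : Tendsto (fun B : ℝ => B⁻¹ * (R + R')) atTop (𝓝 0) := by
      simpa using tendsto_inv_atTop_zero.mul_const (R + R')
    refine squeeze_zero' (Eventually.of_forall fun _ => norm_nonneg _) ?_ hz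
    filter_upwards [eventually_gt_atTop 0] with B hB
    have : B⁻¹ • J (s (fl (B • y))) - y = B⁻¹ • (J (s (fl (B • y))) - B • y) := by
      rw [smul_sub, inv_smul_smul₀ hB.ne']
    rw [this, norm_smul, Real.norm_of_nonneg (by positivity)]
    gcongr
    exact hdisp _
  have hVmem : ∀ B, 0 < B → ∀ y, y ∈ V B ↔ B⁻¹ • J (s (fl (B • y))) ∈ A := by
    intro B hB y
    simp only [V, U, Set.mem_preimage, Set.mem_ofPred_eq]
    rw [Set.mem_smul_set_iff_inv_smul_mem₀ hB.ne']
  have hlim : Tendsto (fun B => μ (V B)) atTop (𝓝 (μ (interior A))) := by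
    refine tendsto_measure_of_ae_tendsto_indicator atTop isOpen_interior.measurableSet
      (fun B => (hUm B).preimage (measurable_const_smul B))
      (Metric.isClosed_closedBall (x := (0:E)) (ε := C + (R + R'))).measurableSet
      (Metric.isBounded_closedBall.measure_lt_top.ne) ?_ ?_
    · filter_upwards [eventually_ge_atTop 1] with B hB1 y hy
      have hB : 0 < B := by linarith
      rw [hVmem B hB] at hy
      have h1 := hC _ hy
      rw [mem_closedBall_zero_iff]
      have h2 : ‖B⁻¹ • J (s (fl (B • y))) - y‖ ≤ R + R' := by
        have : B⁻¹ • J (s (fl (B • y))) - y = B⁻¹ • (J (s (fl (B • y))) - B • y) := by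
          rw [smul_sub, inv_smul_smul₀ hB.ne']
        rw [this, norm_smul, Real.norm_of_nonneg (by positivity)]
        calc _ ≤ 1 * (R + R') := by
              gcongr
              · exact inv_le_one_of_one_le₀ hB1
              · exact hdisp _
          _ = _ := one_mul _
      calc ‖y‖ = ‖B⁻¹ • J (s (fl (B • y))) - (B⁻¹ • J (s (fl (B • y))) - y)‖ := by congr 1; abel
        _ ≤ _ := (norm_sub_le _ _).trans (add_le_add h1 h2)
    · have hnf : ∀ᵐ y ∂μ, y ∉ frontier A := measure_eq_zero_iff_ae_notMem.1 hfr
      filter_upwards [hnf] with y hy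
      by_cases hyi : y ∈ interior A
      · filter_upwards [(hconv y).eventually (isOpen_interior.mem_nhds hyi),
          eventually_gt_atTop 0] with B h1 hB
        rw [hVmem B hB]
        exact iff_of_true (interior_subset h1) hyi
      · have hyc : y ∈ (closure A)ᶜ := by
          intro h; exact hy ⟨h, hyi⟩
        filter_upwards [(hconv y).eventually (isClosed_closure.isOpen_compl.mem_nhds hyc),
          eventually_gt_atTop 0] with B h1 hB
        rw [hVmem B hB]
        exact iff_of_false (fun h => h1 (subset_closure h)) hyi
  have hfinA : μ (interior A) ≠ ⊤ := (hA.subset interior_subset).measure_lt_top.ne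
  have hlim2 := ((ENNReal.tendsto_toReal hfinA).comp hlim).div_const (c * Nat.card Q)
  rw [← hae] at hlim2
  refine hlim2.congr' ?_
  filter_upwards [eventually_gt_atTop 0] with B hB
  simp only [Function.comp]
  rw [hVμ B hB, hUreal]
  have : (N B) = {x : Λ | J x ∈ B • A ∧ φ x = t} := rfl
  rw [this]
  field_simp

/-- Counting in a union of residue classes. -/
lemma aux_count_union {E Λ Q : Type*} [NormedAddCommGroup E] [NormedSpace ℝ E]
    [FiniteDimensional ℝ E] [MeasurableSpace E] [BorelSpace E] (μ : Measure E)
    [μ.IsAddHaarMeasure] [AddCommGroup Λ] [Countable Λ] (J : Λ →+ E) (fl : E → Λ) (R : ℝ)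
    (hR : ∀ y, ‖J (fl y) - y‖ ≤ R) (c : ℝ) (hc : 0 < c)
    (hfl : ∀ l, MeasurableSet (fl ⁻¹' {l}) ∧ μ (fl ⁻¹' {l}) = ENNReal.ofReal c)
    [AddCommGroup Q] [Finite Q] (φ : Λ →+ Q) (hφ : Function.Surjective φ) (T : Set Q)
    (A : Set E) (hA : Bornology.IsBounded A) (hfr : μ (frontier A) = 0) :
    (∀ B : ℝ, 0 < B → {x : Λ | J x ∈ B • A ∧ φ x ∈ T}.Finite) ∧
    Tendsto (fun B : ℝ => (Nat.card {x : Λ | J x ∈ B • A ∧ φ x ∈ T} : ℝ)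
      / B ^ (Module.finrank ℝ E)) atTop
      (𝓝 ((μ A).toReal / c * (Nat.card T / Nat.card Q))) := by
  classical
  have := Fintype.ofFinite Q
  have key := fun t => aux_count_class μ J fl R hR c hc hfl φ hφ t A hA hfr
  have hun : ∀ B : ℝ, {x : Λ | J x ∈ B • A ∧ φ x ∈ T}
      = ⋃ t ∈ T.toFinset, {x : Λ | J x ∈ B • A ∧ φ x = t} := by
    intro B; ext x; simp [and_comm]
  have hfin : ∀ B : ℝ, 0 < B → {x : Λ | J x ∈ B • A ∧ φ x ∈ T}.Finite := by
    intro B hB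
    rw [hun]
    exact T.toFinset.finite_toSet.biUnion (fun t _ => (key t).1 B hB)
  refine ⟨hfin, ?_⟩
  have hsum : Tendsto (fun B : ℝ => ∑ t ∈ T.toFinset,
      (Nat.card {x : Λ | J x ∈ B • A ∧ φ x = t} : ℝ) / B ^ (Module.finrank ℝ E)) atTop
      (𝓝 (∑ t ∈ T.toFinset, (μ A).toReal / (c * Nat.card Q))) :=
    tendsto_finsetSum _ (fun t _ => (key t).2)
  have hval : ∑ t ∈ T.toFinset, (μ A).toReal / (c * Nat.card Q)
      = (μ A).toReal / c * (Nat.card T / Nat.card Q) := by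
    rw [Finset.sum_const, nsmul_eq_mul, Nat.card_coe_set_eq, Set.ncard_eq_toFinset_card']
    ring
  rw [← hval]
  refine hsum.congr' ?_
  filter_upwards [eventually_gt_atTop 0] with B hB
  rw [← Finset.sum_div, ← Nat.cast_sum]
  congr 2
  simp only [Nat.card_coe_set_eq]
  have hf := hfin B hB
  rw [Set.ncard_eq_toFinset_card _ hf,
    Finset.card_eq_sum_card_fiberwise (f := φ) (t := T.toFinset)]
  · refine Finset.sum_congr rfl fun t ht => ?_
    rw [Set.ncard_eq_toFinset_card _ ((key t).1 B hB)]
    congr 1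
    ext x
    simp only [Set.Finite.mem_toFinset, Finset.mem_filter, Set.mem_ofPred_eq]
    have : t ∈ T := by simpa using ht
    constructor
    · rintro ⟨h1, rfl⟩; exact ⟨⟨h1, this⟩, rfl⟩
    · rintro ⟨⟨h1, _⟩, h2⟩; exact ⟨h1, h2⟩
  · intro x hx
    simp only [Set.Finite.coe_toFinset, Set.mem_ofPred_eq] at hx
    simpa using hx.2

lemma aux_measure_quot {Y : Type*} [AddCommGroup Y] [MeasurableSpace Y] [MeasurableAdd Y]
    (μ : Measure Y) [μ.IsAddLeftInvariant] (hμ : μ Set.univ = 1) (H : AddSubgroup Y)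
    (hH : MeasurableSet (H : Set Y)) [Finite (Y ⧸ H)] (T : Set (Y ⧸ H)) :
    MeasurableSet ((QuotientAddGroup.mk : Y → Y ⧸ H) ⁻¹' T) ∧
    (μ ((QuotientAddGroup.mk : Y → Y ⧸ H) ⁻¹' T)).toReal = Nat.card T / Nat.card (Y ⧸ H) := by
  classical
  have := Fintype.ofFinite (Y ⧸ H)
  have hfib : ∀ q : Y ⧸ H, MeasurableSet ((QuotientAddGroup.mk : Y → Y ⧸ H) ⁻¹' {q}) ∧
      μ ((QuotientAddGroup.mk : Y → Y ⧸ H) ⁻¹' {q}) = μ H := by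
    intro q
    obtain ⟨y, rfl⟩ := QuotientAddGroup.mk_surjective q
    have : (QuotientAddGroup.mk : Y → Y ⧸ H) ⁻¹' {(y : Y ⧸ H)} = (fun z => -y + z) ⁻¹' (H : Set Y) := by
      ext z
      simp only [Set.mem_preimage, Set.mem_singleton_iff, SetLike.mem_coe]
      rw [eq_comm, QuotientAddGroup.eq]
    rw [this]
    exact ⟨hH.preimage (measurable_const_add _), measure_preimage_add _ _ _⟩
  have hun : ∀ T : Set (Y ⧸ H), (QuotientAddGroup.mk : Y → Y ⧸ H) ⁻¹' T
      = ⋃ q ∈ T.toFinset, (QuotientAddGroup.mk : Y → Y ⧸ H) ⁻¹' {q} := by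
    intro T; ext y; simp
  have hmeas : ∀ T : Set (Y ⧸ H), μ ((QuotientAddGroup.mk : Y → Y ⧸ H) ⁻¹' T)
      = (Nat.card T : ENNReal) * μ H := by
    intro T
    rw [hun, measure_biUnion_finset]
    · simp_rw [(hfib _).2]
      rw [Finset.sum_const, nsmul_eq_mul, Nat.card_coe_set_eq, Set.ncard_eq_toFinset_card']
    · intro a _ b _ hab
      exact Disjoint.preimage _ (by simpa using hab)
    · exact fun q _ => (hfib q).1
  constructor
  · rw [hun]
    exact Finset.measurableSet_biUnion _ (fun q _ => (hfib q).1)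
  · have h1 := hmeas Set.univ
    rw [Set.preimage_univ, hμ, Nat.card_univ] at h1
    have h2 := congrArg ENNReal.toReal h1
    rw [ENNReal.toReal_mul] at h2
    simp only [ENNReal.toReal_one, ENNReal.toReal_natCast] at h2
    rw [hmeas, ENNReal.toReal_mul, ENNReal.toReal_natCast]
    have : (Nat.card (Y ⧸ H) : ℝ) ≠ 0 := by
      intro h; rw [h] at h2; simp at h2
    field_simp
    rw [mul_right_comm, mul_assoc, ← h2, mul_one]

lemma aux_approx {Y : Type*} [AddCommGroup Y] [TopologicalSpace Y] [IsTopologicalAddGroup Y]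
    [MeasurableSpace Y] [MeasurableAdd Y]
    (μ : Measure Y) [μ.IsAddLeftInvariant] (hμ : μ Set.univ = 1) (H : ℕ → AddSubgroup Y)
    (hH : ∀ m, MeasurableSet (H m : Set Y)) (hfin : ∀ m, Finite (Y ⧸ H m))
    (hopen : ∀ m, IsOpen (H m : Set Y)) (hanti : Antitone H)
    (hbas : ∀ W ∈ 𝓝 (0 : Y), ∃ m, (H m : Set Y) ⊆ W) (Ω : Set Y) (hfr : μ (frontier Ω) = 0) :
    Tendsto (fun m => (Nat.card {q : Y ⧸ H m | ∀ y : Y, (y : Y ⧸ H m) = q → y ∈ Ω} : ℝ)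
      / Nat.card (Y ⧸ H m)) atTop (𝓝 (μ Ω).toReal) ∧
    Tendsto (fun m => (Nat.card {q : Y ⧸ H m | ∃ y ∈ Ω, (y : Y ⧸ H m) = q} : ℝ)
      / Nat.card (Y ⧸ H m)) atTop (𝓝 (μ Ω).toReal) := by
  have hle1 : ∀ s, μ s ≠ ⊤ := fun s =>
    ((measure_mono (Set.subset_univ s)).trans_lt (by rw [hμ]; simp)).ne
  have hint : μ (interior Ω) = μ Ω := by
    refine le_antisymm (measure_mono interior_subset) ?_
    calc μ Ω ≤ μ (interior Ω ∪ frontier Ω) := measure_mono (by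
            rw [← closure_eq_interior_union_frontier]; exact subset_closure)
      _ ≤ μ (interior Ω) + μ (frontier Ω) := measure_union_le _ _
      _ = μ (interior Ω) := by rw [hfr, add_zero]
  have hclo : μ (closure Ω) = μ Ω := by
    refine le_antisymm ?_ (measure_mono subset_closure)
    calc μ (closure Ω) ≤ μ (Ω ∪ frontier Ω) := measure_mono (by
            rw [← closure_eq_self_union_frontier])
      _ ≤ μ Ω + μ (frontier Ω) := measure_union_le _ _
      _ = μ Ω := by rw [hfr, add_zero]
  let P : ℕ → Set Y := fun m => (QuotientAddGroup.mk : Y → Y ⧸ H m) ⁻¹'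
    {q : Y ⧸ H m | ∀ y : Y, (y : Y ⧸ H m) = q → y ∈ Ω}
  let N : ℕ → Set Y := fun m => (QuotientAddGroup.mk : Y → Y ⧸ H m) ⁻¹'
    {q : Y ⧸ H m | ∃ y ∈ Ω, (y : Y ⧸ H m) = q}
  have hPmem : ∀ m z, z ∈ P m ↔ ∀ h ∈ H m, z + h ∈ Ω := by
    intro m z
    simp only [P, Set.mem_preimage, Set.mem_ofPred_eq]
    constructor
    · intro h w hw
      apply h
      rw [eq_comm, QuotientAddGroup.eq]
      simpa using hw
    · intro h y hy
      rw [eq_comm, QuotientAddGroup.eq] at hy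
      simpa using h _ hy
  have hNmem : ∀ m z, z ∈ N m ↔ ∃ h ∈ H m, z + h ∈ Ω := by
    intro m z
    simp only [N, Set.mem_preimage, Set.mem_ofPred_eq]
    constructor
    · rintro ⟨y, hy, h⟩
      rw [eq_comm, QuotientAddGroup.eq] at h
      exact ⟨_, h, by simpa using hy⟩
    · rintro ⟨h, hh, hz⟩
      refine ⟨_, hz, ?_⟩
      rw [eq_comm, QuotientAddGroup.eq]
      simpa using hh
  have hnhds : ∀ (z : Y) (W : Set Y), W ∈ 𝓝 z → ∃ m, ∀ h ∈ H m, z + h ∈ W := by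
    intro z W hW
    have : (fun h => z + h) ⁻¹' W ∈ 𝓝 (0 : Y) := by
      apply (continuous_const_add z).continuousAt.preimage_mem_nhds
      simpa using hW
    obtain ⟨m, hm⟩ := hbas _ this
    exact ⟨m, fun h hh => hm hh⟩
  have hopen' : ∀ m (z : Y), (fun w => -z + w) ⁻¹' (H m : Set Y) ∈ 𝓝 z := by
    intro m z
    apply (continuous_const_add (-z)).continuousAt.preimage_mem_nhds
    simpa using (hopen m).mem_nhds (H m).zero_mem
  have hPU : ⋃ m, P m = interior Ω := by
    ext z
    simp only [Set.mem_iUnion, hPmem]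
    constructor
    · rintro ⟨m, hm⟩
      rw [mem_interior_iff_mem_nhds]
      filter_upwards [hopen' m z] with w hw
      simpa using hm _ hw
    · intro h
      exact hnhds z Ω (mem_interior_iff_mem_nhds.1 h)
  have hNI : ⋂ m, N m = closure Ω := by
    ext z
    simp only [Set.mem_iInter, hNmem]
    constructor
    · intro h
      rw [mem_closure_iff_nhds]
      intro W hW
      obtain ⟨m, hm⟩ := hnhds z W hW
      obtain ⟨w, hw, hw'⟩ := h m
      exact ⟨_, hm w hw, hw'⟩
    · intro h m
      obtain ⟨w, hw, hw'⟩ := mem_closure_iff_nhds.1 h _ (hopen' m z)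
      exact ⟨_, hw, by simpa using hw'⟩
  constructor
  · have h1 : Tendsto (fun m => μ (P m)) atTop (𝓝 (μ (⋃ m, P m))) := by
      apply tendsto_measure_iUnion_atTop
      intro a b hab z hz
      rw [hPmem] at hz ⊢
      exact fun h hh => hz h (hanti hab hh)
    rw [hPU, hint] at h1
    refine ((ENNReal.tendsto_toReal (hle1 _)).comp h1).congr fun m => ?_
    have := hfin m
    exact (aux_measure_quot μ hμ (H m) (hH m) _).2
  · have h1 : Tendsto (fun m => μ (N m)) atTop (𝓝 (μ (⋂ m, N m))) := by
      apply tendsto_measure_iInter_atTop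
      · intro m
        have := hfin m
        exact (aux_measure_quot μ hμ (H m) (hH m) _).1.nullMeasurableSet
      · intro a b hab z hz
        rw [hNmem] at hz ⊢
        obtain ⟨h, hh, hz⟩ := hz
        exact ⟨h, hanti hab hh, hz⟩
      · exact ⟨0, hle1 _⟩
    rw [hNI, hclo] at h1
    refine ((ENNReal.tendsto_toReal (hle1 _)).comp h1).congr fun m => ?_
    have := hfin m
    exact (aux_measure_quot μ hμ (H m) (hH m) _).2

open WithZero in
/-- The subgroup of `𝔬_v` of elements of valuation at most `exp (-m)`. -/
noncomputable def auxBall {k : Type*} [Field k] [NumberField k] (v : HeightOneSpectrum (𝓞 k))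
    (m : ℕ) : AddSubgroup (v.adicCompletionIntegers k) where
  carrier := {x | Valued.v (x : v.adicCompletion k) ≤ exp (-(m : ℤ))}
  zero_mem' := by simp
  add_mem' := by
    intro a b ha hb
    have ha' : Valued.v (a : v.adicCompletion k) ≤ exp (-(m : ℤ)) := ha
    have hb' : Valued.v (b : v.adicCompletion k) ≤ exp (-(m : ℤ)) := hb
    have : Valued.v ((a : v.adicCompletion k) + b) ≤ exp (-(m : ℤ)) :=
      (Valuation.map_add _ _ _).trans (max_le ha' hb')
    exact this
  neg_mem' := by
    intro a ha
    have : Valued.v (-(a : v.adicCompletion k)) ≤ exp (-(m : ℤ)) := by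
      rw [Valuation.map_neg]; exact ha
    exact this

open WithZero in
lemma auxBall_mem {k : Type*} [Field k] [NumberField k] (v : HeightOneSpectrum (𝓞 k))
    (m : ℕ) (x : v.adicCompletionIntegers k) :
    x ∈ auxBall v m ↔ Valued.v (x : v.adicCompletion k) ≤ exp (-(m : ℤ)) := Iff.rfl

open WithZero in
lemma auxBall_algebraMap {k : Type*} [Field k] [NumberField k] (v : HeightOneSpectrum (𝓞 k))
    (m : ℕ) (a : 𝓞 k) (ha : a ∈ v.asIdeal ^ m) :
    algebraMap (𝓞 k) (v.adicCompletionIntegers k) a ∈ auxBall v m := by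
  rw [auxBall_mem]
  have h1 : ((algebraMap (𝓞 k) (v.adicCompletionIntegers k) a : v.adicCompletionIntegers k) :
    v.adicCompletion k) = ((algebraMap (𝓞 k) k a : k) : v.adicCompletion k) := rfl
  rw [h1, HeightOneSpectrum.valuedAdicCompletion_eq_valuation',
    HeightOneSpectrum.valuation_of_algebraMap, HeightOneSpectrum.intValuation_le_pow_iff_mem]
  exact ha

open WithZero in
lemma auxBall_isOpen' {k : Type*} [Field k] [NumberField k] (v : HeightOneSpectrum (𝓞 k))
    (m : ℕ) : IsOpen {x : v.adicCompletion k | Valued.v x ≤ exp (-(m : ℤ))} := by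
  obtain ⟨x0, hx0⟩ := HeightOneSpectrum.valuedAdicCompletion_surjective (K := k) v
    (exp (-(m : ℤ)))
  have h := Valued.isOpen_closedBall (v.adicCompletion k)
    (r := Valuation.restrict (Valued.v (R := v.adicCompletion k)) x0) (by
      intro h
      rw [Valuation.restrict_eq_zero_iff] at h
      rw [h] at hx0
      exact exp_ne_zero hx0.symm)
  simpa only [Valuation.restrict_le_iff, hx0] using h

lemma auxBall_isOpen {k : Type*} [Field k] [NumberField k] (v : HeightOneSpectrum (𝓞 k))
    (m : ℕ) : IsOpen (auxBall v m : Set (v.adicCompletionIntegers k)) :=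
  (auxBall_isOpen' v m).preimage continuous_subtype_val

lemma auxBall_antitone {k : Type*} [Field k] [NumberField k] (v : HeightOneSpectrum (𝓞 k)) :
    Antitone (auxBall v) := by
  intro a b hab x hx
  rw [auxBall_mem] at hx ⊢
  refine hx.trans ?_
  rw [WithZero.exp_le_exp]
  omega

open WithZero in
lemma auxBall_basis {k : Type*} [Field k] [NumberField k] (v : HeightOneSpectrum (𝓞 k))
    (W : Set (v.adicCompletionIntegers k)) (hW : W ∈ 𝓝 0) :
    ∃ m, (auxBall v m : Set (v.adicCompletionIntegers k)) ⊆ W := by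
  rw [nhds_subtype_eq_comap, mem_comap] at hW
  obtain ⟨t, ht, htW⟩ := hW
  obtain ⟨γ, hγ⟩ := Valued.mem_nhds_zero.1 ht
  have hne : MonoidWithZeroHom.ValueGroup₀.embedding γ.1 ≠ (0 : ℤᵐ⁰) := by
    simp
  obtain ⟨m, hm⟩ : ∃ m : ℕ, exp (-(m : ℤ)) < MonoidWithZeroHom.ValueGroup₀.embedding γ.1 := by
    refine ⟨(log (MonoidWithZeroHom.ValueGroup₀.embedding γ.1)).natAbs + 1, ?_⟩
    rw [← lt_log_iff_exp_lt hne]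
    omega
  refine ⟨m, fun x hx => htW (hγ ?_)⟩
  show Valued.v.restrict (x : v.adicCompletion k) < γ.1
  rw [Valuation.restrict_lt_iff_lt_embedding]
  exact lt_of_le_of_lt hx hm

open WithZero in
lemma auxBall_dense {k : Type*} [Field k] [NumberField k] (v : HeightOneSpectrum (𝓞 k))
    (m : ℕ) (x : v.adicCompletionIntegers k) :
    ∃ a : 𝓞 k, algebraMap (𝓞 k) (v.adicCompletionIntegers k) a - x ∈ auxBall v m := by
  have hop : IsOpen ((fun z : v.adicCompletion k => z - x) ⁻¹'
      {x : v.adicCompletion k | Valued.v x ≤ exp (-(m : ℤ))}) :=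
    (auxBall_isOpen' v m).preimage (continuous_id.sub continuous_const)
  obtain ⟨z, hz⟩ := (HeightOneSpectrum.denseRange_algebraMap k v).exists_mem_open hop
    ⟨x, by simp⟩
  have hz' : Valued.v ((z : v.adicCompletion k) - x) ≤ exp (-(m : ℤ)) := hz
  have hz1 : v.valuation k z ≤ 1 := by
    rw [← HeightOneSpectrum.valuedAdicCompletion_eq_valuation']
    have : (z : v.adicCompletion k) = ((z : v.adicCompletion k) - x) + x := by ring
    rw [this]
    refine (Valuation.map_add _ _ _).trans (max_le (hz'.trans ?_) x.2)
    rw [← exp_zero, exp_le_exp]; omega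
  obtain ⟨a, ha⟩ := v.exists_valuation_sub_lt_of_integer hz1
    (Units.mk0 (exp (-(m : ℤ))) exp_ne_zero)
  refine ⟨a, ?_⟩
  rw [auxBall_mem]
  have h1 : ((algebraMap (𝓞 k) (v.adicCompletionIntegers k) a - x : v.adicCompletionIntegers k) :
    v.adicCompletion k) = ((algebraMap (𝓞 k) k a - z : k) : v.adicCompletion k)
      + ((z : v.adicCompletion k) - x) := by
    have h2 : ((algebraMap (𝓞 k) (v.adicCompletionIntegers k) a - x :
      v.adicCompletionIntegers k) : v.adicCompletion k) =
      ((algebraMap (𝓞 k) k a : k) : v.adicCompletion k) - x := rfl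
    have h3 : ((algebraMap (𝓞 k) k a - z : k) : v.adicCompletion k) =
      ((algebraMap (𝓞 k) k a : k) : v.adicCompletion k) - z :=
      map_sub (algebraMap k (v.adicCompletion k)) _ _
    rw [h2, h3]; ring
  rw [h1]
  refine (Valuation.map_add _ _ _).trans (max_le ?_ hz')
  rw [HeightOneSpectrum.valuedAdicCompletion_eq_valuation']
  exact ha.le

/-- The box version of `auxBall`. -/
noncomputable def auxBox {k : Type*} [Field k] [NumberField k] (n : ℕ)
    (v : HeightOneSpectrum (𝓞 k)) (m : ℕ) : AddSubgroup (Fin n → v.adicCompletionIntegers k) :=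
  AddSubgroup.pi Set.univ (fun _ => auxBall v m)

lemma auxBox_mem {k : Type*} [Field k] [NumberField k] (n : ℕ)
    (v : HeightOneSpectrum (𝓞 k)) (m : ℕ) (x : Fin n → v.adicCompletionIntegers k) :
    x ∈ auxBox n v m ↔ ∀ i, x i ∈ auxBall v m := by
  simp [auxBox, AddSubgroup.mem_pi]

lemma auxBox_coe {k : Type*} [Field k] [NumberField k] (n : ℕ)
    (v : HeightOneSpectrum (𝓞 k)) (m : ℕ) :
    (auxBox n v m : Set (Fin n → v.adicCompletionIntegers k))
      = Set.pi Set.univ (fun _ => (auxBall v m : Set (v.adicCompletionIntegers k))) := by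
  ext x; simp [auxBox_mem]

lemma auxBox_finite {k : Type*} [Field k] [NumberField k] (n : ℕ)
    (v : HeightOneSpectrum (𝓞 k)) (m : ℕ) :
    Finite ((Fin n → v.adicCompletionIntegers k) ⧸ auxBox n v m) := by
  have : Finite (𝓞 k ⧸ v.asIdeal ^ m) :=
    Ideal.finiteQuotientOfFreeOfNeBot _ (pow_ne_zero _ v.ne_bot)
  let f : (Fin n → 𝓞 k ⧸ v.asIdeal ^ m) → (Fin n → v.adicCompletionIntegers k) ⧸ auxBox n v m :=
    fun c => QuotientAddGroup.mk (fun i =>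
      algebraMap (𝓞 k) (v.adicCompletionIntegers k) (Quotient.out (c i)))
  refine Finite.of_surjective f ?_
  intro q
  obtain ⟨y, rfl⟩ := QuotientAddGroup.mk_surjective q
  choose a ha using fun i => auxBall_dense v m (y i)
  refine ⟨fun i => Ideal.Quotient.mk _ (a i), ?_⟩
  simp only [f]
  rw [eq_comm, QuotientAddGroup.eq, auxBox_mem]
  intro i
  have h1 : Quotient.out (Ideal.Quotient.mk (v.asIdeal ^ m) (a i)) - a i ∈ v.asIdeal ^ m := by
    rw [← Ideal.Quotient.eq]
    exact Quotient.out_eq _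
  have h2 := (auxBall v m).add_mem (auxBall_algebraMap v m _ h1) (ha i)
  rw [map_sub] at h2
  convert h2 using 1
  simp only [Pi.add_apply, Pi.neg_apply]
  ring

lemma aux_approx_adic {k : Type*} [Field k] [NumberField k] (n : ℕ)
    (v : HeightOneSpectrum (𝓞 k)) (μ : Measure (Fin n → v.adicCompletionIntegers k))
    (hHaar : μ.IsAddHaarMeasure) (hmass : μ Set.univ = 1)
    (Ω : Set (Fin n → v.adicCompletionIntegers k)) (hfr : μ (frontier Ω) = 0) :
    Tendsto (fun m => (Nat.card {q : _ ⧸ auxBox n v m | ∀ y : Fin n → v.adicCompletionIntegers k,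
        (y : _ ⧸ auxBox n v m) = q → y ∈ Ω} : ℝ)
      / Nat.card (_ ⧸ auxBox n v m)) atTop (𝓝 (μ Ω).toReal) ∧
    Tendsto (fun m => (Nat.card {q : _ ⧸ auxBox n v m | ∃ y ∈ Ω, (y : _ ⧸ auxBox n v m) = q} : ℝ)
      / Nat.card (_ ⧸ auxBox n v m)) atTop (𝓝 (μ Ω).toReal) := by
  refine aux_approx μ hmass (auxBox n v) ?_ (auxBox_finite n v) ?_ ?_ ?_ Ω hfr
  · intro m
    rw [auxBox_coe]
    exact MeasurableSet.univ_pi (fun _ => (auxBall_isOpen v m).measurableSet)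
  · intro m
    rw [auxBox_coe]
    exact isOpen_set_pi Set.finite_univ (fun _ _ => auxBall_isOpen v m)
  · intro a b hab x hx
    rw [auxBox_mem] at hx ⊢
    exact fun i => auxBall_antitone v hab (hx i)
  · intro W hW
    rw [nhds_pi, Filter.mem_pi] at hW
    obtain ⟨I, hI, t, ht, htW⟩ := hW
    choose m hm using fun i => auxBall_basis v (t i) (ht i)
    obtain ⟨M, hM⟩ := (Set.finite_range m).bddAbove
    refine ⟨M, fun x hx => htW fun i _ => hm i ?_⟩
    exact auxBall_antitone v (hM ⟨i, rfl⟩) ((auxBox_mem n v M x).1 hx i)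

/-- Simultaneous approximation: surjectivity onto the product of the residue groups. -/
lemma aux_surj {k : Type*} [Field k] [NumberField k] (n : ℕ)
    (S : Finset (HeightOneSpectrum (𝓞 k))) (m : ℕ)
    (y : ∀ v : S, Fin n → v.1.adicCompletionIntegers k) :
    ∃ x : Fin n → 𝓞 k, ∀ v : S,
      (fun i => algebraMap (𝓞 k) (v.1.adicCompletionIntegers k) (x i)) - y v ∈ auxBox n v.1 m := by
  choose a ha using fun (v : S) i => auxBall_dense v.1 m (y v i)
  have := fun i => IsDedekindDomain.exists_forall_sub_mem_ideal (s := S)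
    (fun v : HeightOneSpectrum (𝓞 k) => v.asIdeal) (fun _ => m)
    (fun v _ => v.prime) (fun v _ w _ hvw h => hvw (HeightOneSpectrum.ext h)) (fun v => a v i)
  choose x hx using this
  refine ⟨x, fun v => ?_⟩
  rw [auxBox_mem]
  intro i
  have h2 := (auxBall v.1 m).add_mem (auxBall_algebraMap v.1 m _ (hx i v.1 v.2)) (ha v i)
  rw [map_sub] at h2
  convert h2 using 1
  simp only [Pi.sub_apply]
  ring

lemma aux_sandwich (f : ℝ → ℝ) (L U : ℕ → ℝ → ℝ) (l u : ℕ → ℝ) (c : ℝ)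
    (hL : ∀ m, Tendsto (L m) atTop (𝓝 (l m))) (hU : ∀ m, Tendsto (U m) atTop (𝓝 (u m)))
    (hl : Tendsto l atTop (𝓝 c)) (hu : Tendsto u atTop (𝓝 c))
    (hLf : ∀ m, ∀ᶠ B in atTop, L m B ≤ f B) (hfU : ∀ m, ∀ᶠ B in atTop, f B ≤ U m B) :
    Tendsto f atTop (𝓝 c) := by
  rw [tendsto_order]
  constructor
  · intro a ha
    obtain ⟨m, hm⟩ := ((tendsto_order.1 hl).1 a ha).exists
    filter_upwards [(tendsto_order.1 (hL m)).1 a hm, hLf m] with B h1 h2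
    linarith
  · intro a ha
    obtain ⟨m, hm⟩ := ((tendsto_order.1 hu).2 a ha).exists
    filter_upwards [(tendsto_order.1 (hU m)).2 a hm, hfU m] with B h1 h2
    linarith

lemma aux_card_pi {I : Type*} [Fintype I] {Q : I → Type*} (T : ∀ i, Set (Q i)) :
    Nat.card (Set.pi Set.univ T) = ∏ i, Nat.card (T i) := by
  rw [Nat.card_congr (Equiv.Set.univPi T), Nat.card_pi]

lemma aux_finite_count (k : Type*) [Field k] [NumberField k]
    (n : ℕ) (d : ℕ) (hd : d = Module.finrank ℚ k)
    (ι : 𝓞 k →ₗ[ℤ] (Fin d → ℝ)) (hinj : Function.Injective ι)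
    (hspan : Submodule.span ℝ (Set.range ι) = ⊤)
    (μinf : Measure (Fin d → ℝ)) [μinf.IsAddHaarMeasure]
    (Ωinf : Set (Fin n → Fin d → ℝ)) (hbdd : Bornology.IsBounded Ωinf)
    (Ωp : ∀ v : HeightOneSpectrum (𝓞 k), Set (Fin n → v.adicCompletionIntegers k))
    (μp : ∀ v : HeightOneSpectrum (𝓞 k), Measure (Fin n → v.adicCompletionIntegers k))
    (hHaar : ∀ v, (μp v).IsAddHaarMeasure) (hmass : ∀ v, μp v Set.univ = 1)
    (hfrontinf : Measure.pi (fun _ : Fin n => μinf) (frontier Ωinf) = 0)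
    (hfrontp : ∀ v, μp v (frontier (Ωp v)) = 0)
    (S : Finset (HeightOneSpectrum (𝓞 k))) :
    (∀ B : ℝ, 0 < B → {x : Fin n → 𝓞 k | (fun i => ι (x i)) ∈ B • Ωinf}.Finite) ∧
    Tendsto (fun B : ℝ =>
        (Nat.card {x : Fin n → 𝓞 k | (fun i => ι (x i)) ∈ B • Ωinf ∧
          ∀ v ∈ S,
            (fun i => algebraMap (𝓞 k) (v.adicCompletionIntegers k) (x i)) ∈ Ωp v} : ℝ)
          / B ^ (d * n))
      atTop (𝓝 ((Measure.pi (fun _ : Fin n => μinf) Ωinf).toReal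
          / (ZLattice.covolume (LinearMap.range ι) μinf) ^ n *
        ∏ v ∈ S, (μp v (Ωp v)).toReal)) ∧
    0 < ZLattice.covolume (LinearMap.range ι) μinf := by
  classical
  obtain ⟨fl, R, hR, hfl⟩ := aux_exists_floor k d hd ι hinj hspan μinf
  set c := ZLattice.covolume (LinearMap.range ι) μinf with hcdef
  have hc : 0 < c := (hfl 0).2.2
  have hR0 : 0 ≤ R := (norm_nonneg _).trans (hR 0)
  let J : (Fin n → 𝓞 k) →+ (Fin n → Fin d → ℝ) :=
    { toFun := fun x i => ι (x i)
      map_zero' := by ext; simp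
      map_add' := by intro x y; ext; simp }
  let Fl : (Fin n → Fin d → ℝ) → (Fin n → 𝓞 k) := fun y i => fl (y i)
  have hJR : ∀ y, ‖J (Fl y) - y‖ ≤ R := by
    intro y
    rw [pi_norm_le_iff_of_nonneg hR0]
    intro i
    exact hR (y i)
  have hFl : ∀ l, MeasurableSet (Fl ⁻¹' {l}) ∧
      Measure.pi (fun _ : Fin n => μinf) (Fl ⁻¹' {l}) = ENNReal.ofReal (c ^ n) := by
    intro l
    have : Fl ⁻¹' {l} = Set.pi Set.univ (fun i => fl ⁻¹' {l i}) := by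
      ext y; simp [Fl, funext_iff]
    rw [this]
    refine ⟨MeasurableSet.univ_pi (fun i => (hfl (l i)).1), ?_⟩
    rw [Measure.pi_pi]
    simp_rw [(hfl _).2.1]
    rw [Finset.prod_const, Finset.card_univ, Fintype.card_fin, ENNReal.ofReal_pow hc.le]
  have hfr : Module.finrank ℝ (Fin n → Fin d → ℝ) = d * n := by
    rw [Module.finrank_pi_fintype]; simp [mul_comm]
  have hcount : Countable (𝓞 k) := by
    have := (RingOfIntegers.basis k).equivFun.toEquiv.injective.countable
    exact this
  let Q : ℕ → Type _ := fun m =>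
    ∀ v : S, (Fin n → v.1.adicCompletionIntegers k) ⧸ auxBox n v.1 m
  have hQfin : ∀ m, Finite (Q m) := by
    intro m
    have := fun v : S => auxBox_finite n v.1 m
    exact Pi.finite
  let φ : ∀ m, (Fin n → 𝓞 k) →+ Q m := fun m =>
    { toFun := fun x v => QuotientAddGroup.mk
        (fun i => algebraMap (𝓞 k) (v.1.adicCompletionIntegers k) (x i))
      map_zero' := by
        funext v
        simp only [Pi.zero_apply, map_zero]
        rfl
      map_add' := by
        intro x y
        funext v
        simp only [Pi.add_apply, map_add]
        rfl }
  have hφ : ∀ m, Function.Surjective (φ m) := by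
    intro m q
    choose y hy using fun v : S => QuotientAddGroup.mk_surjective (q v)
    obtain ⟨x, hx⟩ := aux_surj n S m y
    refine ⟨x, ?_⟩
    funext v
    rw [← hy v]
    show QuotientAddGroup.mk _ = _
    rw [eq_comm, QuotientAddGroup.eq, neg_add_eq_sub]
    exact hx v
  have key := fun m (T : Set (Q m)) =>
    have := hQfin m
    aux_count_union (Measure.pi (fun _ : Fin n => μinf)) J Fl R hJR (c ^ n) (pow_pos hc n) hFl
      (φ m) (hφ m) T Ωinf hbdd hfrontinf
  have hfin : ∀ B : ℝ, 0 < B → {x : Fin n → 𝓞 k | (fun i => ι (x i)) ∈ B • Ωinf}.Finite := by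
    intro B hB
    have := (key 0 Set.univ).1 B hB
    simpa [J] using this
  refine ⟨hfin, ?_, hc⟩
  let Tm : ∀ m (v : S), Set ((Fin n → v.1.adicCompletionIntegers k) ⧸ auxBox n v.1 m) :=
    fun m v => {q | ∀ y : Fin n → v.1.adicCompletionIntegers k,
        (y : _ ⧸ auxBox n v.1 m) = q → y ∈ Ωp v.1}
  let Tp : ∀ m (v : S), Set ((Fin n → v.1.adicCompletionIntegers k) ⧸ auxBox n v.1 m) :=
    fun m v => {q | ∃ y ∈ Ωp v.1, (y : _ ⧸ auxBox n v.1 m) = q}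
  have hprod : ∀ f : HeightOneSpectrum (𝓞 k) → ℝ, ∏ v ∈ S, f v = ∏ v : S, f v.1 :=
    fun f => (Finset.prod_coe_sort S f).symm
  have hratio : ∀ m (T : ∀ v : S, Set ((Fin n → v.1.adicCompletionIntegers k) ⧸ auxBox n v.1 m)),
      ((Nat.card (Set.pi Set.univ T) : ℝ) / Nat.card (Q m))
        = ∏ v : S, ((Nat.card (T v) : ℝ) /
          Nat.card ((Fin n → v.1.adicCompletionIntegers k) ⧸ auxBox n v.1 m)) := by
    intro m T
    rw [aux_card_pi, Nat.card_pi, Finset.prod_div_distrib]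
    push_cast
    rfl
  have happ := fun v : S => aux_approx_adic n v.1 (μp v.1) (hHaar _) (hmass _) (Ωp v.1) (hfrontp _)
  refine aux_sandwich _
    (fun m B => (Nat.card {x : Fin n → 𝓞 k | J x ∈ B • Ωinf ∧ φ m x ∈ Set.pi Set.univ (Tm m)} : ℝ)
      / B ^ (d * n))
    (fun m B => (Nat.card {x : Fin n → 𝓞 k | J x ∈ B • Ωinf ∧ φ m x ∈ Set.pi Set.univ (Tp m)} : ℝ)
      / B ^ (d * n))
    (fun m => (Measure.pi (fun _ : Fin n => μinf) Ωinf).toReal / c ^ n *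
      ∏ v : S, ((Nat.card (Tm m v) : ℝ) /
          Nat.card ((Fin n → v.1.adicCompletionIntegers k) ⧸ auxBox n v.1 m)))
    (fun m => (Measure.pi (fun _ : Fin n => μinf) Ωinf).toReal / c ^ n *
      ∏ v : S, ((Nat.card (Tp m v) : ℝ) /
          Nat.card ((Fin n → v.1.adicCompletionIntegers k) ⧸ auxBox n v.1 m)))
    _ (fun m => ?_) (fun m => ?_) ?_ ?_ ?_ ?_
  · have := (key m (Set.pi Set.univ (Tm m))).2
    rwa [hratio, hfr] at this
  · have := (key m (Set.pi Set.univ (Tp m))).2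
    rwa [hratio, hfr] at this
  · rw [hprod]
    exact (tendsto_finsetProd _ (fun v _ => (happ v).1)).const_mul _
  · rw [hprod]
    exact (tendsto_finsetProd _ (fun v _ => (happ v).2)).const_mul _
  · intro m
    filter_upwards [eventually_gt_atTop 0] with B hB
    gcongr
    rw [Nat.card_coe_set_eq, Nat.card_coe_set_eq]
    refine Set.ncard_le_ncard ?_ ((hfin B hB).subset fun x hx => hx.1)
    rintro x ⟨h1, h2⟩
    exact ⟨h1, fun v hv => h2 ⟨v, hv⟩ (Set.mem_univ _) _ rfl⟩
  · intro m
    filter_upwards [eventually_gt_atTop 0] with B hB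
    gcongr
    rw [Nat.card_coe_set_eq, Nat.card_coe_set_eq]
    refine Set.ncard_le_ncard ?_ ((hfin B hB).subset fun x hx => hx.1)
    rintro x ⟨h1, h2⟩
    exact ⟨h1, fun v _ => ⟨_, h2 v.1 v.2, rfl⟩⟩


lemma aux_final {V X : Type*} (N : V → ℕ) (hN : ∀ M, {v | N v ≤ M}.Finite) (a : V → ℝ)
    (ha0 : ∀ v, 0 < a v) (ha1 : ∀ v, a v ≤ 1) (κ : ℝ) (hκ : 0 < κ)
    (E : ℝ → X → Prop) (hE : ∀ B, 0 < B → {x | E B x}.Finite) (P : V → X → Prop) (e : ℕ)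
    (hS : ∀ S : Finset V, Tendsto (fun B : ℝ =>
      (Nat.card {x | E B x ∧ ∀ v ∈ S, P v x} : ℝ) / B ^ e) atTop (𝓝 (κ * ∏ v ∈ S, a v)))
    (hlim : Tendsto (fun M : ℕ => limsup (fun B : ℝ =>
      (Nat.card {x | E B x ∧ ∃ v, M < N v ∧ ¬ P v x} : ℝ) / B ^ e) atTop) atTop (𝓝 0)) :
    Multipliable a ∧ Tendsto (fun B : ℝ =>
      (Nat.card {x | E B x ∧ ∀ v, P v x} : ℝ) / B ^ e) atTop (𝓝 (κ * ∏' v, a v)) ∧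
      κ * ∏' v, a v ≠ 0 := by
  classical
  -- convergence of the product
  have hanti : Antitone (fun S : Finset V => ∏ v ∈ S, a v) := by
    intro S T hST
    show ∏ v ∈ T, a v ≤ ∏ v ∈ S, a v
    rw [← Finset.prod_sdiff hST]
    exact mul_le_of_le_one_left (Finset.prod_nonneg (fun v _ => (ha0 v).le))
      (Finset.prod_le_one (fun v _ => (ha0 v).le) (fun v _ => ha1 v))
  have hbb : BddBelow (Set.range (fun S : Finset V => ∏ v ∈ S, a v)) :=
    ⟨0, by rintro _ ⟨S, rfl⟩; exact Finset.prod_nonneg (fun v _ => (ha0 v).le)⟩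
  have hprod : HasProd a (⨅ S : Finset V, ∏ v ∈ S, a v) := tendsto_atTop_ciInf hanti hbb
  have hmul : Multipliable a := ⟨_, hprod⟩
  refine ⟨hmul, ?_⟩
  rw [hprod.tprod_eq]
  set p := ⨅ S : Finset V, ∏ v ∈ S, a v with hp
  set f : ℕ → ℝ → ℝ := fun M B =>
    (Nat.card {x | E B x ∧ ∃ v, M < N v ∧ ¬ P v x} : ℝ) / B ^ e with hf
  have hf0 : ∀ M, ∀ᶠ B in atTop, 0 ≤ f M B := by
    intro M
    filter_upwards [eventually_gt_atTop 0] with B hB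
    positivity
  have hfle : ∀ M, ∀ᶠ B in atTop, f M B ≤ κ + 1 := by
    intro M
    have h := hS ∅
    simp only [Finset.prod_empty, mul_one] at h
    filter_upwards [eventually_gt_atTop 0, (tendsto_order.1 h).2 (κ + 1) (by linarith)] with B hB h2
    refine le_trans ?_ h2.le
    simp only [hf]
    gcongr
    rw [Nat.card_coe_set_eq, Nat.card_coe_set_eq]
    refine Set.ncard_le_ncard ?_ ((hE B hB).subset fun x hx => hx.1)
    rintro x ⟨h1, h2⟩
    exact ⟨h1, by simp⟩
  have hfb : ∀ M, IsBoundedUnder (· ≤ ·) atTop (f M) := fun M => ⟨κ + 1, hfle M⟩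
  have hfc : ∀ M, IsCoboundedUnder (· ≤ ·) atTop (f M) := fun M =>
    IsBoundedUnder.isCoboundedUnder_le ⟨0, hf0 M⟩
  -- the basic inequality
  have hineq : ∀ M (B : ℝ), 0 < B → ∀ (S : Set V) (W : Set V), (∀ v ∈ W, v ∈ S ∨ M < N v) →
      (Nat.card {x | E B x ∧ ∀ v ∈ S, P v x} : ℝ) / B ^ e ≤
        (Nat.card {x | E B x ∧ ∀ v ∈ W, P v x} : ℝ) / B ^ e + f M B := by
    intro M B hB S W hW
    simp only [hf]
    rw [← add_div]
    gcongr
    norm_cast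
    rw [Nat.card_coe_set_eq, Nat.card_coe_set_eq, Nat.card_coe_set_eq]
    refine le_trans (Set.ncard_le_ncard ?_ (((hE B hB).subset fun x hx => hx.1).union
      ((hE B hB).subset fun x hx => hx.1))) (Set.ncard_union_le _ _)
    rintro x ⟨h1, h2⟩
    by_cases h : ∀ v ∈ W, P v x
    · exact Or.inl ⟨h1, h⟩
    · push Not at h
      obtain ⟨v, hv, hv2⟩ := h
      refine Or.inr ⟨h1, v, ?_, hv2⟩
      rcases hW v hv with h | h
      · exact absurd (h2 v h) hv2
      · exact h
  -- positivity of the product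
  have hppos : 0 < p := by
    obtain ⟨M, hM⟩ := ((tendsto_order.1 hlim).2 (κ / 2) (by positivity)).exists
    have hev := eventually_lt_of_limsup_lt hM (hfb M)
    have hhalf : ∀ S : Finset V, (∀ v ∈ S, M < N v) → 1 / 2 ≤ ∏ v ∈ S, a v := by
      intro S hSM
      have h0 := hS ∅
      simp only [Finset.prod_empty, mul_one] at h0
      have h1 : κ ≤ κ * ∏ v ∈ S, a v + κ / 2 := by
        refine le_of_tendsto_of_tendsto h0 ((hS S).add_const (κ / 2)) ?_
        filter_upwards [hev, eventually_gt_atTop 0] with B h1 h2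
        have := hineq M B h2 (↑(∅ : Finset V)) (↑S) (fun v hv => Or.inr (hSM v hv))
        simp only [Finset.mem_coe] at this
        have h3 : f M B < κ / 2 := h1
        linarith
      have h2 : κ * (1 / 2) ≤ κ * ∏ v ∈ S, a v := by linarith
      exact le_of_mul_le_mul_left h2 hκ
    have hq : 0 < ∏ v ∈ (hN M).toFinset, a v := Finset.prod_pos (fun v _ => ha0 v)
    have : (∏ v ∈ (hN M).toFinset, a v) * (1 / 2) ≤ p := by
      refine le_ciInf fun S => ?_
      rw [← Finset.prod_filter_mul_prod_filter_not S (fun v => N v ≤ M)]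
      refine mul_le_mul ?_ ?_ (by norm_num) (Finset.prod_nonneg (fun v _ => (ha0 v).le))
      · refine hanti ?_
        intro v hv
        simpa using (Finset.mem_filter.1 hv).2
      · refine hhalf _ ?_
        intro v hv
        simpa using (Finset.mem_filter.1 hv).2
    exact lt_of_lt_of_le (by positivity) this
  refine ⟨?_, (mul_pos hκ hppos).ne'⟩
  have hSM : Tendsto (fun M => (hN M).toFinset) atTop atTop := by
    rw [tendsto_atTop]
    intro S
    filter_upwards [eventually_ge_atTop (S.sup N)] with M hM
    intro v hv
    simpa using (Finset.le_sup hv).trans hM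
  have hprodM : Tendsto (fun M => κ * ∏ v ∈ (hN M).toFinset, a v) atTop (𝓝 (κ * p)) :=
    ((tendsto_atTop_ciInf hanti hbb).comp hSM).const_mul κ
  rw [tendsto_order]
  constructor
  · intro b hb
    have hlow := hprodM.sub hlim
    rw [sub_zero] at hlow
    set δ := (κ * p - b) / 2 with hδ
    have hδ0 : 0 < δ := by rw [hδ]; linarith
    obtain ⟨M, hM1, hM2⟩ := (((tendsto_order.1 hprodM).1 (b + δ) (by rw [hδ]; linarith)).and
      ((tendsto_order.1 hlim).2 (δ / 2) (by positivity))).exists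
    filter_upwards [eventually_lt_of_limsup_lt hM2 (hfb M),
      (tendsto_order.1 (hS (hN M).toFinset)).1 (b + δ) hM1, eventually_gt_atTop 0] with B h1 h2 h3
    have := hineq M B h3 (↑(hN M).toFinset) Set.univ (fun v _ => by
      rcases le_or_gt (N v) M with h | h
      · left; simpa using h
      · right; exact h)
    simp only [Finset.mem_coe, Set.mem_univ, forall_true_left] at this
    have h4 : f M B < δ / 2 := h1
    linarith
  · intro b hb
    obtain ⟨M, hM⟩ := ((tendsto_order.1 hprodM).2 b hb).exists
    filter_upwards [(tendsto_order.1 (hS (hN M).toFinset)).2 b hM, eventually_gt_atTop 0] with B h1 h3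
    refine lt_of_le_of_lt ?_ h1
    gcongr
    rw [Nat.card_coe_set_eq, Nat.card_coe_set_eq]
    refine Set.ncard_le_ncard ?_ ((hE B h3).subset fun x hx => hx.1)
    rintro x ⟨h1, h2⟩
    exact ⟨h1, fun v _ => h2 v⟩

theorem sieve_of_ekedahl_number_field (k : Type*) [Field k] [NumberField k]
    (n : ℕ) (d : ℕ) (hd : d = Module.finrank ℚ k)
    -- `k_∞ = 𝔬 ⊗ ℝ`, realized as `ℝ^d` with `𝔬` embedded as a full lattice:
    (ι : 𝓞 k →ₗ[ℤ] (Fin d → ℝ)) (hinj : Function.Injective ι)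
    (hspan : Submodule.span ℝ (Set.range ι) = ⊤)
    (μinf : Measure (Fin d → ℝ)) [μinf.IsAddHaarMeasure]
    -- `μ_∞` gives `𝔬` covolume `|Δ_k|^{1/2}`:
    (hcovol : ZLattice.covolume (LinearMap.range ι) μinf
      = Real.sqrt |(NumberField.discr k : ℝ)|)
    (Ωinf : Set (Fin n → Fin d → ℝ)) (hbdd : Bornology.IsBounded Ωinf)
    (Ωp : ∀ v : HeightOneSpectrum (𝓞 k), Set (Fin n → v.adicCompletionIntegers k))
    (μp : ∀ v : HeightOneSpectrum (𝓞 k), Measure (Fin n → v.adicCompletionIntegers k))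
    (hHaar : ∀ v, (μp v).IsAddHaarMeasure) (hmass : ∀ v, μp v Set.univ = 1)
    (hfrontinf : Measure.pi (fun _ : Fin n => μinf) (frontier Ωinf) = 0)
    (hfrontp : ∀ v, μp v (frontier (Ωp v)) = 0)
    (hposinf : 0 < Measure.pi (fun _ : Fin n => μinf) Ωinf)
    (hposp : ∀ v, 0 < μp v (Ωp v))
    (hlim : Tendsto (fun M : ℕ => limsup (fun B : ℝ =>
        (Nat.card {x : Fin n → 𝓞 k | (fun i => ι (x i)) ∈ B • Ωinf ∧
          ∃ v : HeightOneSpectrum (𝓞 k), M < Ideal.absNorm v.asIdeal ∧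
            (fun i => algebraMap (𝓞 k) (v.adicCompletionIntegers k) (x i)) ∉ Ωp v} : ℝ)
          / B ^ (d * n)) atTop) atTop (𝓝 0)) :
    Multipliable (fun v : HeightOneSpectrum (𝓞 k) => (μp v (Ωp v)).toReal) ∧
    Tendsto (fun B : ℝ =>
        (Nat.card {x : Fin n → 𝓞 k | (fun i => ι (x i)) ∈ B • Ωinf ∧
          ∀ v : HeightOneSpectrum (𝓞 k),
            (fun i => algebraMap (𝓞 k) (v.adicCompletionIntegers k) (x i)) ∈ Ωp v} : ℝ)
          / B ^ (d * n))
      atTop (𝓝 ((Measure.pi (fun _ : Fin n => μinf) Ωinf).toReal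
          / Real.sqrt |(NumberField.discr k : ℝ)| ^ n *
        ∏' v : HeightOneSpectrum (𝓞 k), (μp v (Ωp v)).toReal)) ∧
    (Measure.pi (fun _ : Fin n => μinf) Ωinf).toReal
        / Real.sqrt |(NumberField.discr k : ℝ)| ^ n *
      (∏' v : HeightOneSpectrum (𝓞 k), (μp v (Ωp v)).toReal) ≠ 0 := by
  have hfc := aux_finite_count k n d hd ι hinj hspan μinf Ωinf hbdd Ωp μp hHaar hmass
    hfrontinf hfrontp
  rw [hcovol] at hfc
  have hμfin : Measure.pi (fun _ : Fin n => μinf) Ωinf ≠ ⊤ := hbdd.measure_lt_top.ne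
  have hle : ∀ v, μp v (Ωp v) ≤ 1 := fun v => (hmass v) ▸ measure_mono (Set.subset_univ _)
  refine aux_final (fun v : HeightOneSpectrum (𝓞 k) => Ideal.absNorm v.asIdeal) ?_ _ ?_ ?_ _ ?_
    (fun (B : ℝ) (x : Fin n → 𝓞 k) => (fun i => ι (x i)) ∈ B • Ωinf) (hfc ∅).1
    (fun v x => (fun i => algebraMap (𝓞 k) (v.adicCompletionIntegers k) (x i)) ∈ Ωp v) (d * n)
    (fun S => (hfc S).2.1) hlim
  · intro M
    refine Set.Finite.preimage (f := fun v : HeightOneSpectrum (𝓞 k) => v.asIdeal)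
      (fun v _ w _ h => HeightOneSpectrum.ext h) (Ideal.finite_setOfPred_absNorm_le (S := 𝓞 k) M)
  · intro v
    exact ENNReal.toReal_pos (hposp v).ne' ((hle v).trans_lt ENNReal.one_lt_top).ne
  · intro v
    exact ENNReal.toReal_mono ENNReal.one_ne_top (hle v)
  · exact div_pos (ENNReal.toReal_pos hposinf.ne' hμfin) (pow_pos (hfc ∅).2.2 n)
end
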